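/- There exists a universal constant C > 0 with the following property (quaternionic Fefferman inequality, i.e. BMOA(𝔹) ⊆ (H¹(𝔹))*). Let b ∈ H²(𝔹) with coefficients b̌ : ℕ → ℍ, assume that for every I ∈ 𝕊 the radial limits b_I*(θ) = lim_{r→1⁻} b(r·e^{Iθ}) exist for almost every θ, and set B = ‖b‖_{BMOA(𝔹)}. Then for every f ∈ H¹(𝔹) with coefficients f̌ and for every r ∈ (0,1), |∑_{n≥0} rⁿ·conj(b̌(n))·f̌(n)| ≤ C·( B + |b̌(0)| )·‖f‖_{H¹(𝔹)}. -/

import Mathlib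

open scoped Quaternion ENNReal Topology
open MeasureTheory Filter

/-- `e^{Iθ} = cos θ + I sin θ` for an imaginary unit `I`. -/
noncomputable def expQ (I : ℍ[ℝ]) (θ : ℝ) : ℍ[ℝ] := Real.cos θ • (1 : ℍ[ℝ]) + Real.sin θ • I

/-- The BMO seminorm of a function `g : ℝ → ℍ`. -/
noncomputable def bmoSeminorm (g : ℝ → ℍ[ℝ]) : ℝ≥0∞ :=
  ⨆ (α : ℝ) (β : ℝ) (_ : α < β) (_ : β - α ≤ 2 * Real.pi),
    ENNReal.ofReal
      (((β - α)⁻¹ * ∫ θ in α..β, ‖g θ - (β - α)⁻¹ • ∫ t in α..β, g t‖ ^ 2) ^ (1 / 2 : ℝ))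

theorem hasDerivAt_integral_horizontal {U A : ℂ → ℝ}
    (hU : ContinuousOn U {ζ | ζ.re < 0}) (hA : ContinuousOn A {ζ | ζ.re < 0})
    (h : ∀ t θ : ℝ, t < 0 →
      HasDerivAt (fun x : ℝ => U (x + θ * Complex.I)) (A (t + θ * Complex.I)) t)
    {t : ℝ} (ht : t < 0) (L : ℝ) :
    HasDerivAt (fun x : ℝ => ∫ θ in (0 : ℝ)..L, U (x + θ * Complex.I))
      (∫ θ in (0 : ℝ)..L, A (t + θ * Complex.I)) t := by
  have hcont : ∀ {X : ℂ → ℝ}, ContinuousOn X {ζ | ζ.re < 0} → ∀ x : ℝ, x < 0 →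
      Continuous fun θ : ℝ => X (x + θ * Complex.I) := by
    intro X hX x hx
    exact hX.comp_continuous (by fun_prop) (by intro θ; simpa using hx)
  have hcpt : IsCompact ((fun p : ℝ × ℝ => (p.1 + p.2 * Complex.I : ℂ)) ''
      (Set.Icc (2 * t) (t / 2) ×ˢ Set.uIcc 0 L)) :=
    (isCompact_Icc.prod isCompact_uIcc).image (by fun_prop)
  obtain ⟨M, hM⟩ := hcpt.exists_bound_of_continuousOn (hA.mono (by
    rintro _ ⟨p, ⟨hp, -⟩, rfl⟩
    have := hp.2
    simp only [Set.mem_ofPred_eq, Complex.add_re, Complex.ofReal_re, Complex.mul_re, Complex.I_re,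
      Complex.I_im, Complex.ofReal_im]
    linarith))
  refine (intervalIntegral.hasDerivAt_integral_of_dominated_loc_of_deriv_le
    (𝕜 := ℝ)
    (F := fun x θ : ℝ => U (x + θ * Complex.I)) (F' := fun x θ : ℝ => A (x + θ * Complex.I))
    (bound := fun _ => M) (s := Set.Ioo (2 * t) (t / 2))
    (Ioo_mem_nhds (by linarith) (by linarith)) ?_ ?_ ?_ ?_ ?_ ?_).2
  · filter_upwards [Iio_mem_nhds ht] with x hx
    exact (hcont hU x hx).aestronglyMeasurable
  · exact (hcont hU t ht).intervalIntegrable _ _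
  · exact (hcont hA t ht).aestronglyMeasurable
  · refine Eventually.of_forall fun θ hθ x hx => hM _ ⟨(x, θ), ⟨⟨hx.1.le, hx.2.le⟩, ?_⟩, rfl⟩
    exact Set.uIoc_subset_uIcc hθ
  · exact intervalIntegrable_const
  · refine Eventually.of_forall fun θ _ x hx => h x θ ?_
    have := hx.2
    linarith

/-- A function with nonnegative second derivative on `(-∞, 0)` that is bounded above near `-∞`
has nonnegative first derivative. -/
theorem deriv_nonneg_of_convex_of_bounded {m m₁ m₂ : ℝ → ℝ}
    (h₁ : ∀ t < 0, HasDerivAt m (m₁ t) t) (h₂ : ∀ t < 0, HasDerivAt m₁ (m₂ t) t)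
    (hm₂ : ∀ t < 0, 0 ≤ m₂ t) {T M : ℝ} (hT : T < 0) (hM : ∀ t ≤ T, m t ≤ M) :
    ∀ t ≤ T, 0 ≤ m₁ t := by
  intro t ht
  by_contra! hneg
  have hmono : ∀ x ≤ t, m₁ x ≤ m₁ t := by
    intro x hx
    refine (monotoneOn_of_deriv_nonneg (convex_Icc x t) (f := m₁) ?_ ?_ ?_)
      (Set.left_mem_Icc.2 hx) (Set.right_mem_Icc.2 hx) hx
    · exact fun y hy => (h₂ y (by linarith [hy.2])).continuousAt.continuousWithinAt
    · intro y hy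
      rw [interior_Icc] at hy
      exact (h₂ y (by linarith [hy.2])).differentiableAt.differentiableWithinAt
    · intro y hy
      rw [interior_Icc] at hy
      rw [(h₂ y (by linarith [hy.2])).deriv]
      exact hm₂ y (by linarith [hy.2])
  have hgrow : ∀ x ≤ t, m t - m x ≤ m₁ t * (t - x) := by
    intro x hx
    refine (convex_Icc x t).image_sub_le_mul_sub_of_deriv_le (f := m) ?_ ?_ ?_ x
      (Set.left_mem_Icc.2 hx) t (Set.right_mem_Icc.2 hx) hx
    · exact fun y hy => (h₁ y (by linarith [hy.2])).continuousAt.continuousWithinAt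
    · intro y hy
      rw [interior_Icc] at hy
      exact (h₁ y (by linarith [hy.2])).differentiableAt.differentiableWithinAt
    · intro y hy
      rw [interior_Icc] at hy
      rw [(h₁ y (by linarith [hy.2])).deriv]
      exact hmono y hy.2.le
  set d : ℝ := (M - m t + 1) / (-m₁ t) with hd
  have hd0 : 0 ≤ d := div_nonneg (by linarith [hM t ht]) (by linarith)
  have h3 := hgrow (t - d) (by linarith)
  have h4 : m₁ t * (t - (t - d)) = -(M - m t + 1) := by
    have hne : m₁ t ≠ 0 := hneg.ne
    rw [hd]; field_simp; ring
  linarith [hM (t - d) (by linarith)]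

/-- Sub-mean value property of a function that is subharmonic in logarithmic coordinates. -/
theorem le_circleAverage_of_laplacian_nonneg {V : ℂ → ℝ} {A₁ A₂ B₁ B₂ : ℂ → ℝ}
    (hV : ContinuousOn V (Metric.ball 0 1))
    (hA₁ : ContinuousOn A₁ {ζ | ζ.re < 0}) (hA₂ : ContinuousOn A₂ {ζ | ζ.re < 0})
    (hB₂ : ContinuousOn B₂ {ζ | ζ.re < 0})
    (dA₁ : ∀ t θ : ℝ, t < 0 → HasDerivAt (fun x : ℝ => V (Complex.exp (x + θ * Complex.I)))
      (A₁ (t + θ * Complex.I)) t)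
    (dA₂ : ∀ t θ : ℝ, t < 0 → HasDerivAt (fun x : ℝ => A₁ (x + θ * Complex.I))
      (A₂ (t + θ * Complex.I)) t)
    (dB₂ : ∀ t θ : ℝ, t < 0 → HasDerivAt (fun x : ℝ => B₁ (t + x * Complex.I))
      (B₂ (t + θ * Complex.I)) θ)
    (hper : ∀ t : ℝ, t < 0 → B₁ (t + (2 * Real.pi : ℝ) * Complex.I) = B₁ (t + (0 : ℝ) * Complex.I))
    (hlap : ∀ ζ : ℂ, ζ.re < 0 → 0 ≤ A₂ ζ + B₂ ζ)
    {s : ℝ} (hs : 0 < s) (hs1 : s < 1) :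
    V 0 ≤ Real.circleAverage V 0 s := by
  set m : ℝ → ℝ := fun t => ∫ θ in (0 : ℝ)..(2 * Real.pi), V (Complex.exp (t + θ * Complex.I))
  set m₁ : ℝ → ℝ := fun t => ∫ θ in (0 : ℝ)..(2 * Real.pi), A₁ (t + θ * Complex.I)
  set m₂ : ℝ → ℝ := fun t => ∫ θ in (0 : ℝ)..(2 * Real.pi), A₂ (t + θ * Complex.I)
  have hcont : ∀ {X : ℂ → ℝ}, ContinuousOn X {ζ | ζ.re < 0} → ∀ x : ℝ, x < 0 →
      Continuous fun θ : ℝ => X (x + θ * Complex.I) := by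
    intro X hX x hx
    exact hX.comp_continuous (by fun_prop) (by intro θ; simpa using hx)
  have hnorm : ∀ t θ : ℝ, ‖Complex.exp (t + θ * Complex.I)‖ = Real.exp t := by
    intro t θ
    simp [Complex.norm_exp]
  have hU : ContinuousOn (fun ζ => V (Complex.exp ζ)) {ζ | ζ.re < 0} :=
    hV.comp (by fun_prop) (by
      intro ζ hζ
      simpa [Complex.norm_exp] using hζ)
  have hm : ∀ t < 0, HasDerivAt m (m₁ t) t := fun t ht =>
    hasDerivAt_integral_horizontal hU hA₁ dA₁ ht _
  have hm₁ : ∀ t < 0, HasDerivAt m₁ (m₂ t) t := fun t ht =>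
    hasDerivAt_integral_horizontal hA₁ hA₂ dA₂ ht _
  have hm₂ : ∀ t < 0, 0 ≤ m₂ t := by
    intro t ht
    have hB : ∫ θ in (0 : ℝ)..(2 * Real.pi), B₂ (t + θ * Complex.I) = 0 := by
      rw [intervalIntegral.integral_eq_sub_of_hasDerivAt (fun θ _ => dB₂ t θ ht)
        ((hcont hB₂ t ht).intervalIntegrable _ _), hper t ht, sub_self]
    have : m₂ t = ∫ θ in (0 : ℝ)..(2 * Real.pi),
        (A₂ (t + θ * Complex.I) + B₂ (t + θ * Complex.I)) := by
      rw [intervalIntegral.integral_add ((hcont hA₂ t ht).intervalIntegrable _ _)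
        ((hcont hB₂ t ht).intervalIntegrable _ _), hB, add_zero]
    rw [this]
    exact intervalIntegral.integral_nonneg (by positivity) fun θ _ => hlap _ (by simpa using ht)
  set T := Real.log s
  have hT : T < 0 := Real.log_neg hs hs1
  have hexpT : Real.exp T = s := Real.exp_log hs
  have hball : Metric.closedBall (0 : ℂ) s ⊆ Metric.ball 0 1 :=
    Metric.closedBall_subset_ball hs1
  obtain ⟨M, hM⟩ := (isCompact_closedBall (0 : ℂ) s).exists_bound_of_continuousOn (hV.mono hball)
  have hbd : ∀ t ≤ T, m t ≤ 2 * Real.pi * M := by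
    intro t ht
    have h0 : m t ≤ ∫ _ in (0 : ℝ)..(2 * Real.pi), M := by
      refine intervalIntegral.integral_mono_on (by positivity)
        ((hcont hU t (by linarith)).intervalIntegrable _ _) intervalIntegrable_const ?_
      intro θ _
      refine (le_abs_self _).trans (hM _ ?_)
      rw [mem_closedBall_zero_iff, hnorm, ← hexpT]
      exact Real.exp_le_exp.2 ht
    simpa using h0
  have hder := deriv_nonneg_of_convex_of_bounded hm hm₁ hm₂ hT hbd
  have hmono : ∀ t ≤ T, m t ≤ m T := by
    intro t ht
    refine monotoneOn_of_deriv_nonneg (convex_Icc t T) (f := m) ?_ ?_ ?_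
      (Set.left_mem_Icc.2 ht) (Set.right_mem_Icc.2 ht) ht
    · exact fun y hy => (hm y (by linarith [hy.2])).continuousAt.continuousWithinAt
    · intro y hy
      rw [interior_Icc] at hy
      exact (hm y (by linarith [hy.2])).differentiableAt.differentiableWithinAt
    · intro y hy
      rw [interior_Icc] at hy
      rw [(hm y (by linarith [hy.2])).deriv]
      exact hder y hy.2.le
  have havg : Real.circleAverage V 0 s = (2 * Real.pi)⁻¹ * m T := by
    simp only [Real.circleAverage_def, smul_eq_mul, m, circleMap, Complex.exp_add,
      ← Complex.ofReal_exp, hexpT, zero_add]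
  rw [havg]
  refine le_of_forall_pos_le_add fun ε hε => ?_
  have hV0 : ContinuousAt V 0 := hV.continuousAt (Metric.ball_mem_nhds _ one_pos)
  obtain ⟨δ, hδ, hVδ⟩ := Metric.continuousAt_iff.1 hV0 ε hε
  set t := min T (Real.log (δ / 2))
  have htδ : Real.exp t < δ := by
    calc Real.exp t ≤ Real.exp (Real.log (δ / 2)) := Real.exp_le_exp.2 (min_le_right _ _)
      _ = δ / 2 := Real.exp_log (by positivity)
      _ < δ := by linarith
  have hlow : 2 * Real.pi * (V 0 - ε) ≤ m t := by
    have h0 : ∫ _ in (0 : ℝ)..(2 * Real.pi), (V 0 - ε) ≤ m t := by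
      refine intervalIntegral.integral_mono_on (by positivity) intervalIntegrable_const
        ((hcont hU t ((min_le_left _ _).trans_lt hT)).intervalIntegrable _ _) ?_
      intro θ _
      have := hVδ (x := Complex.exp (t + θ * Complex.I)) (by rwa [dist_zero_right, hnorm])
      rw [Real.dist_eq] at this
      linarith [(abs_lt.1 this).1]
    rwa [intervalIntegral.integral_const, sub_zero, smul_eq_mul] at h0
  have h5 := hlow.trans (hmono t (min_le_left _ _))
  have h6 : V 0 - ε ≤ (2 * Real.pi)⁻¹ * m T := by
    rw [inv_mul_eq_div, le_div_iff₀ (by positivity)]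
    linarith
  linarith

/-- The weight `√P (1 + e^{1 + w/K})`. -/
noncomputable def weight (K P w : ℝ) : ℝ := √P * (1 + Real.exp (1 + w / K))

/-- First derivative of `weight` along a curve. -/
noncomputable def weightDeriv (K P P₁ w w₁ : ℝ) : ℝ :=
  P₁ / (2 * √P) * (1 + Real.exp (1 + w / K)) + √P * (Real.exp (1 + w / K) * (w₁ / K))

/-- Second derivative of `weight` along a curve. -/
noncomputable def weightDeriv₂ (K P P₁ P₂ w w₁ w₂ : ℝ) : ℝ :=
  (P₂ / (2 * √P) - P₁ ^ 2 / (4 * √P ^ 3)) * (1 + Real.exp (1 + w / K)) +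
    P₁ / √P * (Real.exp (1 + w / K) * (w₁ / K)) +
    √P * (Real.exp (1 + w / K) * (w₂ / K + (w₁ / K) ^ 2))

theorem hasDerivAt_weight {K : ℝ} {P w : ℝ → ℝ} {P₁ w₁ s : ℝ} (h0 : 0 < P s)
    (hP : HasDerivAt P P₁ s) (hw : HasDerivAt w w₁ s) :
    HasDerivAt (fun x => weight K (P x) (w x)) (weightDeriv K (P s) P₁ (w s) w₁) s := by
  unfold weight weightDeriv
  have h1 := (hP.sqrt h0.ne').mul (((hw.div_const K).const_add 1).exp.const_add 1)
  exact h1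

theorem hasDerivAt_weightDeriv {K : ℝ} {P P₁ w w₁ : ℝ → ℝ} {P₂ w₂ s : ℝ} (hK : K ≠ 0)
    (h0 : 0 < P s)
    (hP : HasDerivAt P (P₁ s) s) (hw : HasDerivAt w (w₁ s) s)
    (hP₁ : HasDerivAt P₁ P₂ s) (hw₁ : HasDerivAt w₁ w₂ s) :
    HasDerivAt (fun x => weightDeriv K (P x) (P₁ x) (w x) (w₁ x))
      (weightDeriv₂ K (P s) (P₁ s) P₂ (w s) (w₁ s) w₂) s := by
  unfold weightDeriv weightDeriv₂
  have hsq : 0 < √(P s) := Real.sqrt_pos.2 h0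
  have hS := hP.sqrt h0.ne'
  have hE := ((hw.div_const K).const_add 1).exp
  have h1 := ((hP₁.div (hS.const_mul 2) (by positivity)).mul (hE.const_add 1)).add
    (hS.mul (hE.mul (hw₁.div_const K)))
  refine h1.congr_deriv ?_
  dsimp
  field_simp
  ring

/-- Pointwise positivity of the Laplacian of `√K · weight - Re (ω ḡ f)`; here `p`, `q` stand for
the complex derivatives of `|f|²` and `w`. -/
theorem laplacian_weight_nonneg {K P w F f' g' x x' y y' c : ℝ} {p q : ℂ} (hK : 0 < K)
    (hP : 0 < P) (hFP : F ^ 2 ≤ P) (hp : ‖p‖ = F * f') (hw : -K ≤ w)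
    (hx : x + x' = 4 * f' ^ 2) (hy : y + y' = 4 * g' ^ 2) (hc : c ≤ 4 * (f' * g')) :
    0 ≤ √K * (weightDeriv₂ K P (2 * p.re) x w q.re y +
      weightDeriv₂ K P (-(2 * p.im)) x' w (-q.im) y') - c := by
  unfold weightDeriv₂
  have hR : 0 < √P := Real.sqrt_pos.2 hP
  have hL : 0 < √K := Real.sqrt_pos.2 hK
  have hE : 1 ≤ Real.exp (1 + w / K) := by
    refine Real.one_le_exp ?_
    rw [← sub_nonneg, sub_zero]
    have : -1 ≤ w / K := by rw [le_div_iff₀ hK]; linarith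
    linarith
  have hPR : P = √P ^ 2 := (Real.sq_sqrt hP.le).symm
  have hKL : K = √K ^ 2 := (Real.sq_sqrt hK.le).symm
  generalize Real.exp (1 + w / K) = E at *
  have hpp : p.re ^ 2 + p.im ^ 2 = F ^ 2 * f' ^ 2 := by
    rw [← mul_pow, ← hp, Complex.sq_norm, Complex.normSq_apply]; ring
  have hpR : p.re ^ 2 + p.im ^ 2 ≤ √P ^ 2 * f' ^ 2 := by
    rw [hpp, ← hPR]; gcongr
  generalize √P = R at *
  generalize √K = L at *
  subst hPR hKL
  clear hP hK hFP hw hp hpp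
  obtain rfl : x' = 4 * f' ^ 2 - x := by linarith
  obtain rfl : y' = 4 * g' ^ 2 - y := by linarith
  have key : L * ((x / (2 * R) - (2 * p.re) ^ 2 / (4 * R ^ 3)) * (1 + E) +
        2 * p.re / R * (E * (q.re / L ^ 2)) + R * (E * (y / L ^ 2 + (q.re / L ^ 2) ^ 2)) +
      (((4 * f' ^ 2 - x) / (2 * R) - (-(2 * p.im)) ^ 2 / (4 * R ^ 3)) * (1 + E) +
        -(2 * p.im) / R * (E * (-q.im / L ^ 2)) +
        R * (E * ((4 * g' ^ 2 - y) / L ^ 2 + (-q.im / L ^ 2) ^ 2)))) - 4 * (f' * g') =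
      L / R ^ 3 * (R ^ 2 * f' ^ 2 - (p.re ^ 2 + p.im ^ 2)) +
      2 * L * E / R ^ 3 * (R ^ 2 * f' ^ 2 - (p.re ^ 2 + p.im ^ 2)) +
      L * E / R ^ 3 * ((p.re + R ^ 2 * q.re / L ^ 2) ^ 2 + (p.im + R ^ 2 * q.im / L ^ 2) ^ 2) +
      4 * R * g' ^ 2 / L * (E - 1) + (L * f' - 2 * R * g') ^ 2 / (L * R) := by
    field_simp
    ring
  have h1 : 0 ≤ R ^ 2 * f' ^ 2 - (p.re ^ 2 + p.im ^ 2) := by linarith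
  have h2 : 0 ≤ E - 1 := by linarith
  have h3 : 0 ≤ E := by linarith
  have : 0 ≤ L / R ^ 3 * (R ^ 2 * f' ^ 2 - (p.re ^ 2 + p.im ^ 2)) +
      2 * L * E / R ^ 3 * (R ^ 2 * f' ^ 2 - (p.re ^ 2 + p.im ^ 2)) +
      L * E / R ^ 3 * ((p.re + R ^ 2 * q.re / L ^ 2) ^ 2 + (p.im + R ^ 2 * q.im / L ^ 2) ^ 2) +
      4 * R * g' ^ 2 / L * (E - 1) + (L * f' - 2 * R * g') ^ 2 / (L * R) := by positivity
  linarith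
/-- The function whose subharmonicity gives the duality inequality, in terms of the values of
`f`, `g` and of a holomorphic `h` with `|g|² ≤ Re h`. -/
noncomputable def bellman (K ε : ℝ) (ω a b c : ℂ) : ℝ :=
  √K * weight K (‖a‖ ^ 2 + ε ^ 2) (‖b‖ ^ 2 - c.re) - (ω * (starRingEnd ℂ b * a)).re

/-- First derivative of `bellman` along a curve. -/
noncomputable def bellmanDeriv (K ε : ℝ) (ω a a₁ b b₁ c c₁ : ℂ) : ℝ :=
  √K * weightDeriv K (‖a‖ ^ 2 + ε ^ 2) (2 * (starRingEnd ℂ a * a₁).re)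
      (‖b‖ ^ 2 - c.re) (2 * (starRingEnd ℂ b * b₁).re - c₁.re) -
    (ω * (starRingEnd ℂ b₁ * a + starRingEnd ℂ b * a₁)).re

/-- Second derivative of `bellman` along a curve. -/
noncomputable def bellmanDeriv₂ (K ε : ℝ) (ω a a₁ a₂ b b₁ b₂ c c₁ c₂ : ℂ) : ℝ :=
  √K * weightDeriv₂ K (‖a‖ ^ 2 + ε ^ 2) (2 * (starRingEnd ℂ a * a₁).re)
      (2 * ‖a₁‖ ^ 2 + 2 * (starRingEnd ℂ a * a₂).re)
      (‖b‖ ^ 2 - c.re) (2 * (starRingEnd ℂ b * b₁).re - c₁.re)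
      (2 * ‖b₁‖ ^ 2 + 2 * (starRingEnd ℂ b * b₂).re - c₂.re) -
    (ω * (starRingEnd ℂ b₂ * a + 2 * (starRingEnd ℂ b₁ * a₁) + starRingEnd ℂ b * a₂)).re

theorem hasDerivAt_re {a : ℝ → ℂ} {a₁ : ℂ} {s : ℝ} (ha : HasDerivAt a a₁ s) :
    HasDerivAt (fun x => (a x).re) a₁.re s :=
  (Complex.reCLM.hasFDerivAt.comp_hasDerivAt s ha)

theorem hasDerivAt_conj {a : ℝ → ℂ} {a₁ : ℂ} {s : ℝ} (ha : HasDerivAt a a₁ s) :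
    HasDerivAt (fun x => starRingEnd ℂ (a x)) (starRingEnd ℂ a₁) s :=
  ((Complex.conjCLE : ℂ →L[ℝ] ℂ).hasFDerivAt.comp_hasDerivAt s ha)

theorem hasDerivAt_sq_norm {a : ℝ → ℂ} {a₁ : ℂ} {s : ℝ} (ha : HasDerivAt a a₁ s) :
    HasDerivAt (fun x => ‖a x‖ ^ 2) (2 * (starRingEnd ℂ (a s) * a₁).re) s := by
  have h := hasDerivAt_re ((hasDerivAt_conj ha).mul ha)
  have h2 : (fun x => ‖a x‖ ^ 2) = fun x => (starRingEnd ℂ (a x) * a x).re := by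
    ext x
    rw [Complex.conj_mul', ← Complex.ofReal_pow, Complex.ofReal_re]
  rw [h2]
  refine h.congr_deriv ?_
  simp
  ring

section BellmanDerivative

variable {K ε s : ℝ} {ω : ℂ} {a b c : ℝ → ℂ}

theorem hasDerivAt_bellman {a₁ b₁ c₁ : ℂ} (hε : 0 < ε)
    (ha : HasDerivAt a a₁ s) (hb : HasDerivAt b b₁ s) (hc : HasDerivAt c c₁ s) :
    HasDerivAt (fun x => bellman K ε ω (a x) (b x) (c x))
      (bellmanDeriv K ε ω (a s) a₁ (b s) b₁ (c s) c₁) s := by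
  unfold bellman bellmanDeriv
  exact ((hasDerivAt_weight (by positivity) ((hasDerivAt_sq_norm ha).add_const _)
    ((hasDerivAt_sq_norm hb).sub (hasDerivAt_re hc))).const_mul _).sub
    (hasDerivAt_re (((hasDerivAt_conj hb).mul ha).const_mul ω))

theorem hasDerivAt_bellmanDeriv {a₁ b₁ c₁ : ℝ → ℂ} {a₂ b₂ c₂ : ℂ} (hK : K ≠ 0) (hε : 0 < ε)
    (ha : HasDerivAt a (a₁ s) s) (hb : HasDerivAt b (b₁ s) s) (hc : HasDerivAt c (c₁ s) s)
    (ha₁ : HasDerivAt a₁ a₂ s) (hb₁ : HasDerivAt b₁ b₂ s) (hc₁ : HasDerivAt c₁ c₂ s) :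
    HasDerivAt (fun x => bellmanDeriv K ε ω (a x) (a₁ x) (b x) (b₁ x) (c x) (c₁ x))
      (bellmanDeriv₂ K ε ω (a s) (a₁ s) a₂ (b s) (b₁ s) b₂ (c s) (c₁ s) c₂) s := by
  unfold bellmanDeriv bellmanDeriv₂
  have hsq : ∀ {a a₁ : ℝ → ℂ} {a₂ : ℂ}, HasDerivAt a (a₁ s) s → HasDerivAt a₁ a₂ s →
      HasDerivAt (fun x => 2 * (starRingEnd ℂ (a x) * a₁ x).re)
        (2 * ‖a₁ s‖ ^ 2 + 2 * (starRingEnd ℂ (a s) * a₂).re) s := by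
    intro a a₁ a₂ h h₁
    refine ((hasDerivAt_re ((hasDerivAt_conj h).mul h₁)).const_mul 2).congr_deriv ?_
    rw [Complex.conj_mul', Complex.add_re, ← Complex.ofReal_pow, Complex.ofReal_re]
    ring
  refine ((hasDerivAt_weightDeriv (P := fun x => ‖a x‖ ^ 2 + ε ^ 2)
    (P₁ := fun x => 2 * (starRingEnd ℂ (a x) * a₁ x).re)
    (w := fun x => ‖b x‖ ^ 2 - (c x).re)
    (w₁ := fun x => 2 * (starRingEnd ℂ (b x) * b₁ x).re - (c₁ x).re)
    hK (by positivity) ((hasDerivAt_sq_norm ha).add_const _)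
    ((hasDerivAt_sq_norm hb).sub (hasDerivAt_re hc)) (hsq ha ha₁)
    ((hsq hb hb₁).sub (hasDerivAt_re hc₁))).const_mul _).sub ?_
  refine (hasDerivAt_re ((((hasDerivAt_conj hb₁).mul ha).add
    ((hasDerivAt_conj hb).mul ha₁)).const_mul ω)).congr_deriv ?_
  congr 2
  ring

end BellmanDerivative

theorem bellmanDeriv₂_add_nonneg {K ε : ℝ} {ω a a₁ a₂ b b₁ b₂ c c₁ c₂ : ℂ} (hK : 0 < K)
    (hε : 0 < ε) (hω : ‖ω‖ ≤ 1) (hw : -K ≤ ‖b‖ ^ 2 - c.re) :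
    0 ≤ bellmanDeriv₂ K ε ω a a₁ a₂ b b₁ b₂ c c₁ c₂ +
      bellmanDeriv₂ K ε ω a (Complex.I * a₁) (-a₂) b (Complex.I * b₁) (-b₂)
        c (Complex.I * c₁) (-c₂) := by
  have h := laplacian_weight_nonneg (K := K) (P := ‖a‖ ^ 2 + ε ^ 2) (w := ‖b‖ ^ 2 - c.re)
    (F := ‖a‖) (f' := ‖a₁‖) (g' := ‖b₁‖) (p := starRingEnd ℂ a * a₁)
    (q := 2 * (starRingEnd ℂ b * b₁) - c₁)
    (x := 2 * ‖a₁‖ ^ 2 + 2 * (starRingEnd ℂ a * a₂).re)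
    (x' := 2 * ‖a₁‖ ^ 2 - 2 * (starRingEnd ℂ a * a₂).re)
    (y := 2 * ‖b₁‖ ^ 2 + 2 * (starRingEnd ℂ b * b₂).re - c₂.re)
    (y' := 2 * ‖b₁‖ ^ 2 - 2 * (starRingEnd ℂ b * b₂).re + c₂.re)
    (c := 4 * (ω * (starRingEnd ℂ b₁ * a₁)).re) hK (by positivity)
    (by nlinarith [sq_nonneg ε]) (by simp) hw (by ring) (by ring) (by
      have h1 : (ω * (starRingEnd ℂ b₁ * a₁)).re ≤ ‖ω‖ * (‖b₁‖ * ‖a₁‖) := by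
        refine (Complex.re_le_norm _).trans_eq ?_
        simp
      have h2 : ‖ω‖ * (‖b₁‖ * ‖a₁‖) ≤ 1 * (‖b₁‖ * ‖a₁‖) := by gcongr
      linarith)
  unfold bellmanDeriv₂
  have e1 : (starRingEnd ℂ a * (Complex.I * a₁)).re = -(starRingEnd ℂ a * a₁).im := by
    simp; ring
  have e2 : (starRingEnd ℂ b * (Complex.I * b₁)).re = -(starRingEnd ℂ b * b₁).im := by
    simp; ring
  have e3 : (Complex.I * c₁).re = -c₁.im := by simp
  have e4 : ‖Complex.I * a₁‖ = ‖a₁‖ := by simp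
  have e5 : ‖Complex.I * b₁‖ = ‖b₁‖ := by simp
  have e6 : starRingEnd ℂ (Complex.I * b₁) * (Complex.I * a₁) = starRingEnd ℂ b₁ * a₁ := by
    rw [map_mul, Complex.conj_I]
    linear_combination (-(starRingEnd ℂ b₁ * a₁)) * Complex.I_mul_I
  rw [e1, e2, e3, e4, e5, e6]
  refine h.trans_eq ?_
  have e7 : (2 * (starRingEnd ℂ b * b₁) - c₁).re = 2 * (starRingEnd ℂ b * b₁).re - c₁.re := by simp
  have e8 : -(2 * (starRingEnd ℂ b * b₁) - c₁).im =
      2 * -(starRingEnd ℂ b * b₁).im - -c₁.im := by simp; ring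
  rw [e7, e8]
  have e9 : (starRingEnd ℂ a * -a₂).re = -(starRingEnd ℂ a * a₂).re := by simp
  have e10 : (starRingEnd ℂ b * -b₂).re = -(starRingEnd ℂ b * b₂).re := by simp
  rw [e9, e10]
  have e11 : 4 * (ω * (starRingEnd ℂ b₁ * a₁)).re =
      (ω * (starRingEnd ℂ b₂ * a + 2 * (starRingEnd ℂ b₁ * a₁) + starRingEnd ℂ b * a₂)).re +
      (ω * (starRingEnd ℂ (-b₂) * a + 2 * (starRingEnd ℂ b₁ * a₁) + starRingEnd ℂ b * -a₂)).re := by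
    rw [← Complex.add_re, ← Complex.re_ofReal_mul]
    congr 1
    push_cast
    rw [map_neg]
    ring
  rw [e11, Complex.neg_re]
  ring_nf

section BellmanContinuity

variable {X : Type*} [TopologicalSpace X] {S : Set X} {K ε : ℝ} {ω : ℂ}
  {a a₁ a₂ b b₁ b₂ c c₁ c₂ : X → ℂ}

theorem continuousOn_bellman (ha : ContinuousOn a S) (hb : ContinuousOn b S)
    (hc : ContinuousOn c S) : ContinuousOn (fun x => bellman K ε ω (a x) (b x) (c x)) S := by
  unfold bellman weight
  fun_prop

theorem continuousOn_bellmanDeriv (hε : 0 < ε) (ha : ContinuousOn a S) (hb : ContinuousOn b S)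
    (hc : ContinuousOn c S) (ha₁ : ContinuousOn a₁ S) (hb₁ : ContinuousOn b₁ S)
    (hc₁ : ContinuousOn c₁ S) :
    ContinuousOn (fun x => bellmanDeriv K ε ω (a x) (a₁ x) (b x) (b₁ x) (c x) (c₁ x)) S := by
  unfold bellmanDeriv weightDeriv
  fun_prop (disch := intros; positivity)

theorem continuousOn_bellmanDeriv₂ (hε : 0 < ε) (ha : ContinuousOn a S) (hb : ContinuousOn b S)
    (hc : ContinuousOn c S) (ha₁ : ContinuousOn a₁ S) (hb₁ : ContinuousOn b₁ S)
    (hc₁ : ContinuousOn c₁ S) (ha₂ : ContinuousOn a₂ S) (hb₂ : ContinuousOn b₂ S)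
    (hc₂ : ContinuousOn c₂ S) :
    ContinuousOn (fun x => bellmanDeriv₂ K ε ω (a x) (a₁ x) (a₂ x) (b x) (b₁ x) (b₂ x)
      (c x) (c₁ x) (c₂ x)) S := by
  unfold bellmanDeriv₂ weightDeriv₂
  fun_prop (disch := intros; positivity)

end BellmanContinuity

theorem hasDerivAt_comp_horizontal {F : ℂ → ℂ} {F' : ℂ} {t θ : ℝ}
    (hF : HasDerivAt F F' (t + θ * Complex.I)) :
    HasDerivAt (fun x : ℝ => F (x + θ * Complex.I)) F' t := by
  have h := hF.scomp t (((Complex.ofRealCLM.hasDerivAt (x := t)).add_const (θ * Complex.I)))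
  exact h.congr_deriv (by simp)

theorem hasDerivAt_comp_vertical {F : ℂ → ℂ} {F' : ℂ} {t θ : ℝ}
    (hF : HasDerivAt F F' (t + θ * Complex.I)) :
    HasDerivAt (fun x : ℝ => F (t + x * Complex.I)) (Complex.I * F') θ := by
  have h := hF.scomp θ (((Complex.ofRealCLM.hasDerivAt (x := θ)).mul_const Complex.I).const_add
    (t : ℂ))
  exact h.congr_deriv (by simp)

theorem bellman_le_circleAverage {f g h : ℂ → ℂ} (hf : DifferentiableOn ℂ f (Metric.ball 0 1))
    (hg : DifferentiableOn ℂ g (Metric.ball 0 1)) (hh : DifferentiableOn ℂ h (Metric.ball 0 1))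
    {K ε : ℝ} {ω : ℂ} (hK : 0 < K) (hε : 0 < ε) (hω : ‖ω‖ ≤ 1)
    (hw : ∀ z ∈ Metric.ball (0 : ℂ) 1, -K ≤ ‖g z‖ ^ 2 - (h z).re)
    {s : ℝ} (hs : 0 < s) (hs1 : s < 1) :
    bellman K ε ω (f 0) (g 0) (h 0) ≤
      Real.circleAverage (fun z => bellman K ε ω (f z) (g z) (h z)) 0 s := by
  set Ω : Set ℂ := {ζ | ζ.re < 0} with hΩ
  have hΩo : IsOpen Ω := isOpen_lt Complex.continuous_re continuous_const
  have hexp : Set.MapsTo Complex.exp Ω (Metric.ball 0 1) := by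
    intro ζ hζ
    simpa [Complex.norm_exp, hΩ] using hζ
  have hlift : ∀ {φ : ℂ → ℂ}, DifferentiableOn ℂ φ (Metric.ball 0 1) →
      DifferentiableOn ℂ (fun ζ => φ (Complex.exp ζ)) Ω := fun hφ =>
    hφ.comp (Complex.differentiable_exp.differentiableOn) hexp
  have hline : ∀ {t : ℝ} (θ : ℝ), t < 0 → (t + θ * Complex.I : ℂ) ∈ Ω := by
    intro t θ ht
    simpa [hΩ] using ht
  have hder : ∀ {Φ : ℂ → ℂ}, DifferentiableOn ℂ Φ Ω → ∀ ζ ∈ Ω, HasDerivAt Φ (deriv Φ ζ) ζ :=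
    fun hΦ ζ hζ => (hΦ.differentiableAt (hΩo.mem_nhds hζ)).hasDerivAt
  have hperd : ∀ φ : ℂ → ℂ, ∀ t : ℝ,
      deriv (fun ζ => φ (Complex.exp ζ)) (t + (2 * Real.pi : ℝ) * Complex.I) =
        deriv (fun ζ => φ (Complex.exp ζ)) (t + (0 : ℝ) * Complex.I) := by
    intro φ t
    have h1 := deriv_comp_add_const (fun ζ => φ (Complex.exp ζ)) (2 * Real.pi * Complex.I) (t : ℂ)
    simp only [Complex.exp_periodic _] at h1
    simp [h1]
  have hperv : ∀ t : ℝ, Complex.exp (t + (2 * Real.pi : ℝ) * Complex.I) =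
      Complex.exp (t + (0 : ℝ) * Complex.I) := by
    intro t
    have := Complex.exp_periodic (t : ℂ)
    simpa using this
  have hF := hlift hf
  have hG := hlift hg
  have hH := hlift hh
  set F : ℂ → ℂ := fun ζ => f (Complex.exp ζ) with hFdef
  set G : ℂ → ℂ := fun ζ => g (Complex.exp ζ) with hGdef
  set H : ℂ → ℂ := fun ζ => h (Complex.exp ζ) with hHdef
  have hF₁ := hF.deriv hΩo
  have hG₁ := hG.deriv hΩo
  have hH₁ := hH.deriv hΩo
  have hF₂ := (hF₁.deriv hΩo).continuousOn
  have hG₂ := (hG₁.deriv hΩo).continuousOn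
  have hH₂ := (hH₁.deriv hΩo).continuousOn
  refine le_circleAverage_of_laplacian_nonneg (V := fun z => bellman K ε ω (f z) (g z) (h z))
    (A₁ := fun ζ => bellmanDeriv K ε ω (F ζ) (deriv F ζ) (G ζ) (deriv G ζ) (H ζ) (deriv H ζ))
    (A₂ := fun ζ => bellmanDeriv₂ K ε ω (F ζ) (deriv F ζ) (deriv (deriv F) ζ)
      (G ζ) (deriv G ζ) (deriv (deriv G) ζ) (H ζ) (deriv H ζ) (deriv (deriv H) ζ))
    (B₁ := fun ζ => bellmanDeriv K ε ω (F ζ) (Complex.I * deriv F ζ) (G ζ)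
      (Complex.I * deriv G ζ) (H ζ) (Complex.I * deriv H ζ))
    (B₂ := fun ζ => bellmanDeriv₂ K ε ω (F ζ) (Complex.I * deriv F ζ) (-deriv (deriv F) ζ)
      (G ζ) (Complex.I * deriv G ζ) (-deriv (deriv G) ζ)
      (H ζ) (Complex.I * deriv H ζ) (-deriv (deriv H) ζ))
    (continuousOn_bellman hf.continuousOn hg.continuousOn hh.continuousOn)
    (continuousOn_bellmanDeriv hε hF.continuousOn hG.continuousOn hH.continuousOn
      hF₁.continuousOn hG₁.continuousOn hH₁.continuousOn)
    (continuousOn_bellmanDeriv₂ hε hF.continuousOn hG.continuousOn hH.continuousOn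
      hF₁.continuousOn hG₁.continuousOn hH₁.continuousOn hF₂ hG₂ hH₂)
    (continuousOn_bellmanDeriv₂ hε hF.continuousOn hG.continuousOn hH.continuousOn
      (continuousOn_const.mul hF₁.continuousOn) (continuousOn_const.mul hG₁.continuousOn)
      (continuousOn_const.mul hH₁.continuousOn) hF₂.neg hG₂.neg hH₂.neg)
    ?_ ?_ ?_ ?_ ?_ hs hs1
  · intro t θ ht
    exact hasDerivAt_bellman hε
      (hasDerivAt_comp_horizontal (hder hF _ (hline θ ht)))
      (hasDerivAt_comp_horizontal (hder hG _ (hline θ ht)))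
      (hasDerivAt_comp_horizontal (hder hH _ (hline θ ht)))
  · intro t θ ht
    exact hasDerivAt_bellmanDeriv (a₁ := fun x : ℝ => deriv F (x + θ * Complex.I))
      (b₁ := fun x : ℝ => deriv G (x + θ * Complex.I))
      (c₁ := fun x : ℝ => deriv H (x + θ * Complex.I)) hK.ne' hε
      (hasDerivAt_comp_horizontal (hder hF _ (hline θ ht)))
      (hasDerivAt_comp_horizontal (hder hG _ (hline θ ht)))
      (hasDerivAt_comp_horizontal (hder hH _ (hline θ ht)))
      (hasDerivAt_comp_horizontal (hder hF₁ _ (hline θ ht)))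
      (hasDerivAt_comp_horizontal (hder hG₁ _ (hline θ ht)))
      (hasDerivAt_comp_horizontal (hder hH₁ _ (hline θ ht)))
  · intro t θ ht
    have hvert : ∀ {Φ : ℂ → ℂ}, DifferentiableOn ℂ Φ Ω →
        HasDerivAt (fun x : ℝ => Complex.I * Φ (t + x * Complex.I))
          (-deriv Φ (t + θ * Complex.I)) θ := by
      intro Φ hΦ
      refine ((hasDerivAt_comp_vertical (hder hΦ _ (hline θ ht))).const_mul
        Complex.I).congr_deriv ?_
      rw [← mul_assoc, Complex.I_mul_I, neg_one_mul]
    exact hasDerivAt_bellmanDeriv (a₁ := fun x : ℝ => Complex.I * deriv F (t + x * Complex.I))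
      (b₁ := fun x : ℝ => Complex.I * deriv G (t + x * Complex.I))
      (c₁ := fun x : ℝ => Complex.I * deriv H (t + x * Complex.I)) hK.ne' hε
      (hasDerivAt_comp_vertical (hder hF _ (hline θ ht)))
      (hasDerivAt_comp_vertical (hder hG _ (hline θ ht)))
      (hasDerivAt_comp_vertical (hder hH _ (hline θ ht)))
      (hvert hF₁) (hvert hG₁) (hvert hH₁)
  · intro t _
    simp only [hFdef, hGdef, hHdef, hperd, hperv]
  · intro ζ hζ
    exact bellmanDeriv₂_add_nonneg hK hε hω (hw _ (hexp hζ))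

/-- Duality estimate on a circle, given a bound for the Garsia norm of `g` in the form of a
holomorphic `h` with `|g|² ≤ Re h ≤ |g|² + K`. -/
theorem norm_circleAverage_conj_mul_le {f g h : ℂ → ℂ}
    (hf : DifferentiableOn ℂ f (Metric.ball 0 1)) (hg : DifferentiableOn ℂ g (Metric.ball 0 1))
    (hh : DifferentiableOn ℂ h (Metric.ball 0 1)) {K : ℝ} (hK : 0 < K)
    (hw : ∀ z ∈ Metric.ball (0 : ℂ) 1, -K ≤ ‖g z‖ ^ 2 - (h z).re)
    (hw0 : ∀ z ∈ Metric.ball (0 : ℂ) 1, ‖g z‖ ^ 2 - (h z).re ≤ 0)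
    {s : ℝ} (hs : 0 < s) (hs1 : s < 1) :
    ‖Real.circleAverage (fun z => starRingEnd ℂ (g z) * f z) 0 s‖ ≤
      √K * (1 + Real.exp 1) * Real.circleAverage (fun z => ‖f z‖) 0 s + ‖g 0‖ * ‖f 0‖ := by
  have hsph : Metric.sphere (0 : ℂ) |s| ⊆ Metric.ball 0 1 := by
    rw [abs_of_pos hs]
    exact Metric.sphere_subset_closedBall.trans (Metric.closedBall_subset_ball hs1)
  have hfc := hf.continuousOn.mono hsph
  have hgc := hg.continuousOn.mono hsph
  have hhc := hh.continuousOn.mono hsph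
  set X : ℂ := Real.circleAverage (fun z => starRingEnd ℂ (g z) * f z) 0 s with hX
  obtain ⟨ω, hω, hωX⟩ : ∃ ω : ℂ, ‖ω‖ = 1 ∧ ω * X = ‖X‖ := by
    obtain ⟨ω, hω, h2⟩ := Complex.exists_norm_eq_mul_self X
    exact ⟨ω, hω, h2.symm⟩
  have hint : CircleIntegrable (fun z => starRingEnd ℂ (g z) * f z) 0 s := by
    refine ContinuousOn.circleIntegrable' ?_
    fun_prop
  have hre : Real.circleAverage (fun z => (ω * (starRingEnd ℂ (g z) * f z)).re) 0 s = ‖X‖ := by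
    have h1 := (Complex.reCLM ∘L ContinuousLinearMap.mul ℝ ℂ ω).circleAverage_comp_comm hint
    have h2 : (⇑(Complex.reCLM ∘L ContinuousLinearMap.mul ℝ ℂ ω) ∘
        fun z => starRingEnd ℂ (g z) * f z) =
        fun z => (ω * (starRingEnd ℂ (g z) * f z)).re := by
      ext z; simp
    rw [h2] at h1
    rw [h1, ContinuousLinearMap.comp_apply, ContinuousLinearMap.mul_apply', ← hX, hωX]
    simp
  have hnf : CircleIntegrable (fun z => ‖f z‖) 0 s :=
    ContinuousOn.circleIntegrable' (by fun_prop)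
  set c : ℝ := √K * (1 + Real.exp 1) with hc
  have hc0 : 0 ≤ c := by positivity
  refine le_of_forall_pos_le_add fun η hη => ?_
  set ε : ℝ := η / (c + 1)
  have hε : 0 < ε := by positivity
  have h1 := bellman_le_circleAverage hf hg hh hK hε hω.le hw hs hs1
  have hsqrt : ∀ a : ℂ, √(‖a‖ ^ 2 + ε ^ 2) ≤ ‖a‖ + ε := by
    intro a
    refine Real.sqrt_le_iff.2 ⟨by positivity, ?_⟩
    nlinarith [mul_nonneg (norm_nonneg a) hε.le]
  have hub : ∀ z ∈ Metric.sphere (0 : ℂ) |s|, bellman K ε ω (f z) (g z) (h z) ≤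
      c * (‖f z‖ + ε) - (ω * (starRingEnd ℂ (g z) * f z)).re := by
    intro z hz
    have hE : Real.exp (1 + (‖g z‖ ^ 2 - (h z).re) / K) ≤ Real.exp 1 := by
      rw [Real.exp_le_exp]
      have := div_nonpos_of_nonpos_of_nonneg (hw0 z (hsph hz)) hK.le
      linarith
    unfold bellman weight
    have : √K * (√(‖f z‖ ^ 2 + ε ^ 2) * (1 + Real.exp (1 + (‖g z‖ ^ 2 - (h z).re) / K))) ≤
        √K * ((‖f z‖ + ε) * (1 + Real.exp 1)) := by
      gcongr
      exact hsqrt _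
    rw [hc]
    linarith
  have h2 : Real.circleAverage (fun z => bellman K ε ω (f z) (g z) (h z)) 0 s ≤
      c * (Real.circleAverage (fun z => ‖f z‖) 0 s + ε) - ‖X‖ := by
    rw [← hre]
    have i1 : CircleIntegrable (fun z => c * (‖f z‖ + ε)) 0 s :=
      ContinuousOn.circleIntegrable' (by fun_prop)
    have i2 : CircleIntegrable (fun z => (ω * (starRingEnd ℂ (g z) * f z)).re) 0 s :=
      ContinuousOn.circleIntegrable' (by fun_prop)
    have h3 := Real.circleAverage_mono (c := 0) (R := s)
      (ContinuousOn.circleIntegrable' (continuousOn_bellman hfc hgc hhc)) (i1.sub i2) hub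
    refine h3.trans_eq ?_
    rw [Real.circleAverage_sub i1 i2]
    congr 1
    have h4 := Real.circleAverage_fun_smul (a := c) (f := fun z => ‖f z‖ + ε) (c := 0) (R := s)
    simp only [smul_eq_mul] at h4
    rw [h4, Real.circleAverage_fun_add hnf (circleIntegrable_const _ _ _),
      Real.circleAverage_const]
  have h0 : -(‖g 0‖ * ‖f 0‖) ≤ bellman K ε ω (f 0) (g 0) (h 0) := by
    unfold bellman weight
    have h5 : (ω * (starRingEnd ℂ (g 0) * f 0)).re ≤ ‖g 0‖ * ‖f 0‖ := by
      refine (Complex.re_le_norm _).trans_eq ?_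
      simp [hω]
    have : 0 ≤ √K * (√(‖f 0‖ ^ 2 + ε ^ 2) *
      (1 + Real.exp (1 + (‖g 0‖ ^ 2 - (h 0).re) / K))) := by positivity
    linarith
  have hcε : c * ε ≤ η := by
    rw [mul_div_assoc', div_le_iff₀ (by positivity)]
    nlinarith
  have := h0.trans (h1.trans h2)
  linarith [mul_add c (Real.circleAverage (fun z => ‖f z‖) 0 s) ε]

/-- The sum of the power series with coefficients `a`. -/
noncomputable def powerSum (a : ℕ → ℂ) (z : ℂ) : ℂ := ∑' n, z ^ n * a n

theorem differentiableOn_powerSum {a : ℕ → ℂ}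
    (ha : ∀ r : ℝ, 0 ≤ r → r < 1 → Summable fun n => r ^ n * ‖a n‖) :
    DifferentiableOn ℂ (powerSum a) (Metric.ball 0 1) := by
  intro z hz
  rw [mem_ball_zero_iff] at hz
  obtain ⟨r, hzr, hr⟩ := exists_between hz
  have hr0 : 0 ≤ r := (norm_nonneg z).trans hzr.le
  have h : DifferentiableOn ℂ (powerSum a) (Metric.ball 0 r) := by
    refine Complex.differentiableOn_tsum_of_summable_norm (ha r hr0 hr) (fun n => by fun_prop)
      Metric.isOpen_ball ?_
    intro n w hw
    rw [mem_ball_zero_iff] at hw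
    rw [norm_mul, norm_pow]
    gcongr
  exact (h.differentiableAt
    (Metric.isOpen_ball.mem_nhds (by simpa using hzr))).differentiableWithinAt

theorem circleAverage_conj_pow_mul_pow (m n : ℕ) (s : ℝ) :
    Real.circleAverage (fun z => starRingEnd ℂ (z ^ m) * z ^ n) 0 s =
      if m = n then (s : ℂ) ^ (2 * n) else 0 := by
  have h : ∀ θ : ℝ, starRingEnd ℂ (circleMap 0 s θ ^ m) * circleMap 0 s θ ^ n =
      (s : ℂ) ^ (m + n) * Complex.exp (((n - m : ℤ) * Complex.I) * θ) := by
    intro θ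
    simp only [circleMap, zero_add, map_pow, map_mul, Complex.conj_ofReal, ← Complex.exp_conj,
      Complex.conj_I, mul_pow, ← Complex.exp_nat_mul, map_natCast]
    rw [mul_mul_mul_comm, ← pow_add, ← Complex.exp_add]
    congr 2
    push_cast
    ring
  rw [Real.circleAverage_def]
  simp only [h, intervalIntegral.integral_const_mul]
  split_ifs with hmn
  · subst hmn
    simp only [sub_self, Int.cast_zero, zero_mul, Complex.exp_zero,
      intervalIntegral.integral_const, sub_zero, Complex.real_smul, mul_one]
    push_cast
    field_simp
    ring
  · have hk : ((n - m : ℤ) : ℂ) * Complex.I ≠ 0 := by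
      refine mul_ne_zero ?_ Complex.I_ne_zero
      rw [Int.cast_ne_zero]
      omega
    rw [integral_exp_mul_complex hk]
    have : Complex.exp (((n - m : ℤ) : ℂ) * Complex.I * (2 * Real.pi : ℝ)) = 1 := by
      rw [← Complex.exp_int_mul_two_pi_mul_I (n - m)]
      congr 1
      push_cast
      ring
    rw [this]
    simp

/-- Parseval's identity for power series on a circle. -/
theorem circleAverage_conj_powerSum_mul {x y : ℕ → ℂ} {s : ℝ} (hs : 0 ≤ s)
    (hx : Summable fun n => s ^ n * ‖x n‖) (hy : Summable fun n => s ^ n * ‖y n‖) :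
    HasSum (fun n => (s : ℂ) ^ (2 * n) * (starRingEnd ℂ (x n) * y n))
      (Real.circleAverage (fun z => starRingEnd ℂ (powerSum x z) * powerSum y z) 0 s) := by
  set F : ℕ × ℕ → ℂ → ℂ := fun p z => starRingEnd ℂ (z ^ p.1 * x p.1) * (z ^ p.2 * y p.2)
  have hnorm : ∀ (x : ℕ → ℂ) (θ : ℝ) (n : ℕ),
      ‖circleMap 0 s θ ^ n * x n‖ = s ^ n * ‖x n‖ := by
    intro x θ n
    simp [abs_of_nonneg hs]
  have hbd : Summable fun p : ℕ × ℕ => (s ^ p.1 * ‖x p.1‖) * (s ^ p.2 * ‖y p.2‖) :=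
    hx.mul_of_nonneg hy (fun n => by positivity) (fun n => by positivity)
  have hF : ∀ (p : ℕ × ℕ) (θ : ℝ), ‖F p (circleMap 0 s θ)‖ =
      (s ^ p.1 * ‖x p.1‖) * (s ^ p.2 * ‖y p.2‖) := by
    intro p θ
    simp only [F, norm_mul, RCLike.norm_conj]
    rw [← norm_mul, ← norm_mul, hnorm, hnorm]
  have hsum : ∀ θ : ℝ, HasSum (fun p => F p (circleMap 0 s θ))
      (starRingEnd ℂ (powerSum x (circleMap 0 s θ)) * powerSum y (circleMap 0 s θ)) := by
    intro θ
    have h1 : Summable fun n => ‖starRingEnd ℂ (circleMap 0 s θ ^ n * x n)‖ := by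
      simpa only [RCLike.norm_conj, hnorm] using hx
    have h2 : Summable fun n => ‖circleMap 0 s θ ^ n * y n‖ := by
      simpa only [hnorm] using hy
    have h3 := tsum_mul_tsum_of_summable_norm h1 h2
    have h4 : starRingEnd ℂ (powerSum x (circleMap 0 s θ)) =
        ∑' n, starRingEnd ℂ (circleMap 0 s θ ^ n * x n) := Complex.conj_tsum _
    rw [h4, powerSum, h3]
    refine Summable.hasSum (Summable.of_norm ?_)
    simpa only [hF, F] using hbd
  have hint := intervalIntegral.hasSum_integral_of_dominated_convergence (μ := volume)
    (a := 0) (b := 2 * Real.pi) (F := fun p θ => F p (circleMap 0 s θ))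
    (fun p _ => (s ^ p.1 * ‖x p.1‖) * (s ^ p.2 * ‖y p.2‖))
    (fun p => Continuous.aestronglyMeasurable (by fun_prop))
    (fun p => Eventually.of_forall fun θ _ => (hF p θ).le)
    (Eventually.of_forall fun θ _ => hbd) (by simp) (Eventually.of_forall fun θ _ => hsum θ)
  have hint2 := hint.const_smul (2 * Real.pi)⁻¹
  rw [← Real.circleAverage_def
    (f := fun z => starRingEnd ℂ (powerSum x z) * powerSum y z)] at hint2
  have hterm : ∀ p : ℕ × ℕ, (2 * Real.pi)⁻¹ • ∫ θ in (0 : ℝ)..(2 * Real.pi),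
      F p (circleMap 0 s θ) =
      if p.1 = p.2 then (s : ℂ) ^ (2 * p.2) * (starRingEnd ℂ (x p.1) * y p.2) else 0 := by
    intro p
    rw [← Real.circleAverage_def (f := F p)]
    have : F p = fun z => (starRingEnd ℂ (x p.1) * y p.2) •
        (starRingEnd ℂ (z ^ p.1) * z ^ p.2) := by
      ext z
      simp only [F, map_mul, smul_eq_mul]
      ring
    rw [this, Real.circleAverage_fun_smul, circleAverage_conj_pow_mul_pow]
    split_ifs
    · rw [smul_eq_mul, mul_comm]
    · simp
  simp only [hterm] at hint2
  have hinj : Function.Injective fun n : ℕ => (n, n) := fun a b h => (Prod.mk.inj h).1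
  rw [← hinj.hasSum_iff] at hint2
  · simpa [Function.comp_def] using hint2
  · rintro ⟨a, b⟩ hab
    rw [if_neg]
    intro h
    exact hab ⟨a, by simpa using h⟩

theorem summable_pow_mul_norm_of_sq {c : ℕ → ℂ} (hc : Summable fun n => ‖c n‖ ^ 2) (r : ℝ)
    (h0 : 0 ≤ r) (h1 : r < 1) : Summable fun n => r ^ n * ‖c n‖ := by
  have h2 : Summable fun n : ℕ => (r ^ 2) ^ n :=
    summable_geometric_of_lt_one (by positivity) (by nlinarith)
  refine Summable.of_nonneg_of_le (fun n => by positivity) (fun n => ?_) (h2.add hc)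
  have : (r ^ 2) ^ n = (r ^ n) ^ 2 := by rw [← pow_mul, ← pow_mul, mul_comm]
  rw [this]
  nlinarith [sq_nonneg (r ^ n - ‖c n‖), sq_nonneg (r ^ n), sq_nonneg ‖c n‖]

theorem summable_pow_mul_of_norm {a : ℕ → ℂ} {r : ℝ} (ha : Summable fun n => r ^ n * ‖a n‖)
    {z : ℂ} (hz : ‖z‖ ≤ r) : Summable fun n => z ^ n * a n := by
  refine Summable.of_norm_bounded ha fun n => ?_
  rw [norm_mul, norm_pow]
  gcongr

theorem continuous_powerSum_circleMap {a : ℕ → ℂ}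
    (ha : ∀ r : ℝ, 0 ≤ r → r < 1 → Summable fun n => r ^ n * ‖a n‖) {r : ℝ} (h0 : 0 ≤ r)
    (h1 : r < 1) : Continuous fun θ => powerSum a (circleMap 0 r θ) :=
  (differentiableOn_powerSum ha).continuousOn.comp_continuous (continuous_circleMap 0 r)
    fun θ => by simpa [abs_of_nonneg h0] using h1

/-- The squared distance in `H²` between a power series and its dilation. -/
noncomputable def dilationDefect (c : ℕ → ℂ) (r : ℝ) : ℝ := ∑' n, (1 - r ^ n) ^ 2 * ‖c n‖ ^ 2

theorem tendsto_dilationDefect {c : ℕ → ℂ} (hc : Summable fun n => ‖c n‖ ^ 2) :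
    Tendsto (dilationDefect c) (𝓝[<] 1) (𝓝 0) := by
  have h : Tendsto (dilationDefect c) (𝓝[<] 1) (𝓝 (∑' _ : ℕ, (0 : ℝ))) := by
    refine tendsto_tsum_of_dominated_convergence hc (fun n => ?_) ?_
    · have : Continuous fun r : ℝ => (1 - r ^ n) ^ 2 * ‖c n‖ ^ 2 := by fun_prop
      simpa using (this.tendsto 1).mono_left nhdsWithin_le_nhds
    · filter_upwards [Ioo_mem_nhdsLT (zero_lt_one (α := ℝ))] with r hr n
      have h1 : r ^ n ≤ 1 := pow_le_one₀ hr.1.le hr.2.le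
      have h0 : 0 ≤ r ^ n := pow_nonneg hr.1.le n
      rw [Real.norm_eq_abs, abs_of_nonneg (by positivity)]
      have : (1 - r ^ n) ^ 2 ≤ 1 := by nlinarith
      nlinarith [sq_nonneg ‖c n‖]
  simpa using h

theorem circleAverage_sq_norm_powerSum {d : ℕ → ℂ} (hd : Summable fun n => ‖d n‖) :
    Real.circleAverage (fun z => ‖powerSum d z‖ ^ 2) 0 1 = ∑' n, ‖d n‖ ^ 2 := by
  have h := circleAverage_conj_powerSum_mul (s := 1) zero_le_one (x := d) (y := d)
    (by simpa using hd) (by simpa using hd)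
  have e : ∀ w : ℂ, starRingEnd ℂ w * w = ((‖w‖ ^ 2 : ℝ) : ℂ) := fun w => by
    rw [mul_comm, Complex.mul_conj, Complex.normSq_eq_norm_sq]
  simp only [e, Complex.ofReal_one, one_pow, one_mul] at h
  have h2 : Real.circleAverage (fun z => ((‖powerSum d z‖ ^ 2 : ℝ) : ℂ)) 0 1 =
      ((Real.circleAverage (fun z => ‖powerSum d z‖ ^ 2) 0 1 : ℝ) : ℂ) := by
    rw [Real.circleAverage_def, Real.circleAverage_def, intervalIntegral.integral_ofReal]
    simp
  rw [h2] at h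
  exact (Complex.hasSum_ofReal.mp h).tsum_eq.symm

/-- Arc length measure on the unit circle, parametrised by `(0, 2π]`. -/
noncomputable def arcMeasure : Measure ℝ := volume.restrict (Set.Ioc 0 (2 * Real.pi))

instance isFiniteMeasure_arcMeasure : IsFiniteMeasure arcMeasure := by
  unfold arcMeasure
  infer_instance

theorem circleAverage_eq_integral_arcMeasure {E : Type*} [NormedAddCommGroup E] [NormedSpace ℝ E]
    (φ : ℂ → E) :
    Real.circleAverage φ 0 1 = (2 * Real.pi)⁻¹ • ∫ θ, φ (circleMap 0 1 θ) ∂arcMeasure := by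
  rw [Real.circleAverage_def, intervalIntegral.integral_of_le Real.two_pi_pos.le, arcMeasure]

theorem memLp_arcMeasure_of_continuous {E : Type*} [NormedAddCommGroup E] {φ : ℝ → E}
    (hφ : Continuous φ) (p : ℝ≥0∞) : MemLp φ p arcMeasure := by
  obtain ⟨C, hC⟩ := (isCompact_Icc (a := (0 : ℝ)) (b := 2 * Real.pi)).exists_bound_of_continuousOn
    hφ.continuousOn
  refine MemLp.of_bound hφ.aestronglyMeasurable C ?_
  unfold arcMeasure
  filter_upwards [ae_restrict_mem measurableSet_Ioc] with θ hθ
  exact hC θ ⟨hθ.1.le, hθ.2⟩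

theorem eLpNorm_powerSum_sub_le {c : ℕ → ℂ} (hc : Summable fun n => ‖c n‖ ^ 2) {r ρ : ℝ}
    (h0 : 0 ≤ r) (hr : r ≤ ρ) (h1 : ρ < 1) :
    eLpNorm (fun θ => powerSum c (circleMap 0 r θ) - powerSum c (circleMap 0 ρ θ)) 2 arcMeasure ≤
      ENNReal.ofReal ((2 * Real.pi * dilationDefect c r) ^ (2⁻¹ : ℝ)) := by
  have hs := summable_pow_mul_norm_of_sq hc
  set d : ℕ → ℂ := fun n => ((r : ℂ) ^ n - (ρ : ℂ) ^ n) * c n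
  have hdn : ∀ n, ‖d n‖ = |r ^ n - ρ ^ n| * ‖c n‖ := by
    intro n
    simp only [d, norm_mul]
    norm_cast
  have hpow : ∀ n : ℕ, r ^ n ≤ ρ ^ n ∧ ρ ^ n ≤ 1 ∧ 0 ≤ r ^ n := fun n =>
    ⟨pow_le_pow_left₀ h0 hr n, pow_le_one₀ (h0.trans hr) h1.le, by positivity⟩
  have hd : Summable fun n => ‖d n‖ := by
    refine Summable.of_nonneg_of_le (fun n => by positivity) (fun n => ?_)
      (hs ρ (h0.trans hr) h1)
    rw [hdn]
    have := hpow n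
    gcongr
    rw [abs_le]
    constructor <;> linarith
  have hsub : ∀ θ, powerSum c (circleMap 0 r θ) - powerSum c (circleMap 0 ρ θ) =
      powerSum d (circleMap 0 1 θ) := by
    intro θ
    have e1 := summable_pow_mul_of_norm (hs r h0 (hr.trans_lt h1)) (z := circleMap 0 r θ)
      (by simp [abs_of_nonneg h0])
    have e2 := summable_pow_mul_of_norm (hs ρ (h0.trans hr) h1) (z := circleMap 0 ρ θ)
      (by simp [abs_of_nonneg (h0.trans hr)])
    rw [powerSum, powerSum, powerSum, ← e1.tsum_sub e2]
    congr 1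
    ext n
    simp only [circleMap, d, zero_add, mul_pow, Complex.ofReal_one, one_pow]
    ring
  have hcont : Continuous fun θ => powerSum c (circleMap 0 r θ) - powerSum c (circleMap 0 ρ θ) :=
    (continuous_powerSum_circleMap hs h0 (hr.trans_lt h1)).sub
      (continuous_powerSum_circleMap hs (h0.trans hr) h1)
  rw [(memLp_arcMeasure_of_continuous hcont 2).eLpNorm_eq_integral_rpow_norm two_ne_zero
    ENNReal.ofNat_ne_top]
  have hint := circleAverage_sq_norm_powerSum hd
  rw [circleAverage_eq_integral_arcMeasure, smul_eq_mul, inv_mul_eq_iff_eq_mul₀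
    Real.two_pi_pos.ne'] at hint
  simp only [hsub, ENNReal.toReal_ofNat, Real.rpow_ofNat, hint]
  have hle : ∑' n, ‖d n‖ ^ 2 ≤ dilationDefect c r := by
    have key : ∀ n, ‖d n‖ ^ 2 ≤ (1 - r ^ n) ^ 2 * ‖c n‖ ^ 2 := by
      intro n
      rw [hdn, mul_pow, sq_abs]
      have := hpow n
      gcongr ?_ * _
      nlinarith
    have hsum : Summable fun n => (1 - r ^ n) ^ 2 * ‖c n‖ ^ 2 := by
      refine Summable.of_nonneg_of_le (fun n => by positivity) (fun n => ?_) hc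
      have := hpow n
      have : (1 - r ^ n) ^ 2 ≤ 1 := by nlinarith
      nlinarith [sq_nonneg ‖c n‖]
    exact Summable.tsum_le_tsum key
      (Summable.of_nonneg_of_le (fun n => by positivity) key hsum) hsum
  gcongr

/-- `G` is the radial boundary function of the power series with coefficients `c`. -/
def IsRadialLimit (c : ℕ → ℂ) (G : ℂ → ℂ) : Prop :=
  ∀ᵐ θ ∂(volume : Measure ℝ), Tendsto (fun r : ℝ => powerSum c (circleMap 0 r θ)) (𝓝[<] 1)
    (𝓝 (G (circleMap 0 1 θ)))

section RadialLimit

variable {c : ℕ → ℂ} {G : ℂ → ℂ}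

theorem IsRadialLimit.aestronglyMeasurable (hG : IsRadialLimit c G)
    (hc : Summable fun n => ‖c n‖ ^ 2) :
    AEStronglyMeasurable (fun θ => G (circleMap 0 1 θ)) volume := by
  obtain ⟨u, -, hu, hlim⟩ := exists_seq_strictMono_tendsto' (zero_lt_one (α := ℝ))
  refine aestronglyMeasurable_of_tendsto_ae atTop
    (f := fun n θ => powerSum c (circleMap 0 (u n) θ))
    (fun n => (continuous_powerSum_circleMap (summable_pow_mul_norm_of_sq hc) (hu n).1.le
      (hu n).2).aestronglyMeasurable) ?_
  filter_upwards [hG] with θ hθ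
  exact hθ.comp (tendsto_nhdsWithin_iff.mpr ⟨hlim, Eventually.of_forall fun n => (hu n).2⟩)

theorem IsRadialLimit.eLpNorm_sub_le (hG : IsRadialLimit c G)
    (hc : Summable fun n => ‖c n‖ ^ 2) {r : ℝ} (h0 : 0 ≤ r) (h1 : r < 1) :
    eLpNorm (fun θ => powerSum c (circleMap 0 r θ) - G (circleMap 0 1 θ)) 2 arcMeasure ≤
      ENNReal.ofReal ((2 * Real.pi * dilationDefect c r) ^ (2⁻¹ : ℝ)) := by
  obtain ⟨u, -, hu, hlim⟩ := exists_seq_strictMono_tendsto' h1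
  have hs := summable_pow_mul_norm_of_sq hc
  refine Lp.eLpNorm_le_of_ae_tendsto (u := atTop)
    (f := fun n θ => powerSum c (circleMap 0 r θ) - powerSum c (circleMap 0 (u n) θ))
    (Eventually.of_forall fun n => eLpNorm_powerSum_sub_le hc h0 (hu n).1.le (hu n).2)
    (fun n => ((continuous_powerSum_circleMap hs h0 h1).sub
      (continuous_powerSum_circleMap hs (h0.trans (hu n).1.le) (hu n).2)).aestronglyMeasurable) ?_
  refine ae_restrict_of_ae ?_
  filter_upwards [hG] with θ hθ
  exact (hθ.comp (tendsto_nhdsWithin_iff.mpr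
    ⟨hlim, Eventually.of_forall fun n => (hu n).2⟩)).const_sub _

theorem IsRadialLimit.tendsto_eLpNorm (hG : IsRadialLimit c G)
    (hc : Summable fun n => ‖c n‖ ^ 2) :
    Tendsto (fun r : ℝ => eLpNorm
      (fun θ => powerSum c (circleMap 0 r θ) - G (circleMap 0 1 θ)) 2 arcMeasure)
      (𝓝[<] 1) (𝓝 0) := by
  have h : Tendsto (fun r => ENNReal.ofReal ((2 * Real.pi * dilationDefect c r) ^ (2⁻¹ : ℝ)))
      (𝓝[<] 1) (𝓝 0) := by
    have := ENNReal.tendsto_ofReal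
      (((tendsto_dilationDefect hc).const_mul (2 * Real.pi)).rpow_const (p := 2⁻¹)
        (Or.inr (by norm_num)))
    simpa using this
  refine tendsto_of_tendsto_of_tendsto_of_le_of_le' tendsto_const_nhds h
    (Eventually.of_forall fun _ => zero_le) ?_
  filter_upwards [Ioo_mem_nhdsLT (zero_lt_one (α := ℝ))] with r hr
  exact hG.eLpNorm_sub_le hc hr.1.le hr.2

theorem IsRadialLimit.memLp (hG : IsRadialLimit c G) (hc : Summable fun n => ‖c n‖ ^ 2) :
    MemLp (fun θ => G (circleMap 0 1 θ)) 2 arcMeasure := by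
  have hs := summable_pow_mul_norm_of_sq hc
  have h1 := memLp_arcMeasure_of_continuous
    (continuous_powerSum_circleMap hs (r := 2⁻¹) (by norm_num) (by norm_num)) 2
  have h2 : MemLp (fun θ => powerSum c (circleMap 0 2⁻¹ θ) - G (circleMap 0 1 θ)) 2
      arcMeasure := by
    refine ⟨h1.1.sub ((hG.aestronglyMeasurable hc).mono_measure Measure.restrict_le_self), ?_⟩
    exact (hG.eLpNorm_sub_le hc (by norm_num) (by norm_num)).trans_lt ENNReal.ofReal_lt_top
  refine (h1.sub h2).ae_eq (Eventually.of_forall fun θ => ?_)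
  simp

theorem continuous_poissonKernel_circleMap {z : ℂ} (hz : z ∈ Metric.ball (0 : ℂ) 1) :
    Continuous fun θ => poissonKernel 0 z (circleMap 0 1 θ) := by
  rw [poissonKernel_eq_re_herglotzRieszKernel]
  refine Complex.continuous_re.comp ?_
  refine (continuousOn_herglotzRieszKernel_sphere hz).comp_continuous (continuous_circleMap 0 1) ?_
  intro θ
  simp

theorem powerSum_eq_circleAverage_poissonKernel (hG : IsRadialLimit c G)
    (hc : Summable fun n => ‖c n‖ ^ 2) {z : ℂ} (hz : z ∈ Metric.ball (0 : ℂ) 1) :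
    powerSum c z = Real.circleAverage (poissonKernel 0 z • G) 0 1 := by
  have hs := summable_pow_mul_norm_of_sq hc
  have hP := memLp_arcMeasure_of_continuous (continuous_poissonKernel_circleMap hz) 2
  have hPG : AEStronglyMeasurable
      (fun θ => poissonKernel 0 z (circleMap 0 1 θ) • G (circleMap 0 1 θ)) arcMeasure :=
    hP.1.smul (hG.memLp hc).1
  have hlim : Tendsto (fun r : ℝ => ∫ θ, poissonKernel 0 z (circleMap 0 1 θ) •
      powerSum c (circleMap 0 r θ) ∂arcMeasure) (𝓝[<] 1)
      (𝓝 (∫ θ, poissonKernel 0 z (circleMap 0 1 θ) • G (circleMap 0 1 θ) ∂arcMeasure)) := by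
    refine tendsto_integral_of_L1' _ hPG ?_ ?_
    · filter_upwards [Ioo_mem_nhdsLT (zero_lt_one (α := ℝ))] with r hr
      exact memLp_one_iff_integrable.mp (memLp_arcMeasure_of_continuous
        ((continuous_poissonKernel_circleMap hz).smul
          (continuous_powerSum_circleMap hs hr.1.le hr.2)) 1)
    · have h := ENNReal.Tendsto.const_mul (hG.tendsto_eLpNorm hc) (Or.inr hP.2.ne)
      rw [mul_zero] at h
      refine tendsto_of_tendsto_of_tendsto_of_le_of_le' tendsto_const_nhds h
        (Eventually.of_forall fun _ => zero_le) ?_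
      filter_upwards [Ioo_mem_nhdsLT (zero_lt_one (α := ℝ))] with r hr
      refine le_trans (le_of_eq ?_) (eLpNorm_smul_le_mul_eLpNorm (p := 2) (q := 2) (r := 1)
        ((continuous_powerSum_circleMap hs hr.1.le hr.2).aestronglyMeasurable.sub
          (hG.memLp hc).1) hP.1)
      congr 1
      ext θ
      simp [smul_sub]
  have hval : ∀ᶠ r : ℝ in 𝓝[<] 1, ∫ θ, poissonKernel 0 z (circleMap 0 1 θ) •
      powerSum c (circleMap 0 r θ) ∂arcMeasure = (2 * Real.pi) • powerSum c (r * z) := by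
    filter_upwards [Ioo_mem_nhdsLT (zero_lt_one (α := ℝ))] with r hr
    have hd : DiffContOnCl ℂ (fun w => powerSum c (r * w)) (Metric.ball 0 1) := by
      refine DifferentiableOn.diffContOnCl ?_
      rw [closure_ball _ one_ne_zero]
      refine (differentiableOn_powerSum hs).comp (by fun_prop) fun w hw => ?_
      rw [mem_closedBall_zero_iff] at hw
      rw [mem_ball_zero_iff, norm_mul, Complex.norm_real, Real.norm_eq_abs, abs_of_pos hr.1]
      nlinarith [hr.1, hr.2, norm_nonneg w]
    have := hd.circleAverage_poissonKernel_smul hz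
    rw [circleAverage_eq_integral_arcMeasure] at this
    rw [← this, smul_inv_smul₀ Real.two_pi_pos.ne']
    congr 1
    ext θ
    simp [circleMap]
  have hlim2 : Tendsto (fun r : ℝ => (2 * Real.pi) • powerSum c (r * z)) (𝓝[<] 1)
      (𝓝 ((2 * Real.pi) • powerSum c z)) := by
    have hcont := ((differentiableOn_powerSum hs).differentiableAt
      (Metric.isOpen_ball.mem_nhds hz)).continuousAt
    have h1 : Tendsto (fun r : ℝ => (r : ℂ) * z) (𝓝[<] 1) (𝓝 z) := by
      have : Continuous fun r : ℝ => (r : ℂ) * z := by fun_prop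
      simpa using (this.tendsto 1).mono_left nhdsWithin_le_nhds
    exact (hcont.tendsto.comp h1).const_smul _
  have heq := tendsto_nhds_unique (hlim.congr' hval) hlim2
  rw [circleAverage_eq_integral_arcMeasure]
  simp only [Pi.smul_apply', heq]
  rw [inv_smul_smul₀ Real.two_pi_pos.ne']

end RadialLimit

theorem integral_mul_sq_norm_sub {a b : ℝ} {p : ℝ → ℝ} {u : ℝ → ℂ} (c : ℂ)
    (hp : IntervalIntegrable p volume a b)
    (hpu : IntervalIntegrable (fun θ => (p θ : ℂ) * u θ) volume a b)
    (hpu2 : IntervalIntegrable (fun θ => p θ * ‖u θ‖ ^ 2) volume a b) :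
    ∫ θ in a..b, p θ * ‖u θ - c‖ ^ 2 =
      (∫ θ in a..b, p θ * ‖u θ‖ ^ 2) -
        2 * (starRingEnd ℂ c * ∫ θ in a..b, (p θ : ℂ) * u θ).re + ‖c‖ ^ 2 * ∫ θ in a..b, p θ := by
  have e : ∀ θ, p θ * ‖u θ - c‖ ^ 2 =
      (p θ * ‖u θ‖ ^ 2 - 2 * Complex.reCLM (starRingEnd ℂ c * ((p θ : ℂ) * u θ))) +
        ‖c‖ ^ 2 * p θ := by
    intro θ
    rw [← Complex.normSq_eq_norm_sq, ← Complex.normSq_eq_norm_sq, ← Complex.normSq_eq_norm_sq,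
      Complex.normSq_sub]
    simp [Complex.normSq_apply]
    ring
  have h1 : IntervalIntegrable (fun θ => starRingEnd ℂ c * ((p θ : ℂ) * u θ)) volume a b :=
    hpu.const_mul _
  have h2 : IntervalIntegrable
      (fun θ => Complex.reCLM (starRingEnd ℂ c * ((p θ : ℂ) * u θ))) volume a b := by
    constructor
    · exact Complex.reCLM.integrable_comp h1.1
    · exact Complex.reCLM.integrable_comp h1.2
  simp only [e]
  rw [intervalIntegral.integral_add (hpu2.sub (h2.const_mul 2)) (hp.const_mul _),
    intervalIntegral.integral_sub hpu2 (h2.const_mul 2), intervalIntegral.integral_const_mul,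
    intervalIntegral.integral_const_mul, Complex.reCLM.intervalIntegral_comp_comm h1,
    intervalIntegral.integral_const_mul]
  rfl

theorem integral_sq_norm_sub_eq_add {a b : ℝ} (hab : a < b) {u : ℝ → ℂ} (c : ℂ)
    (hu : IntervalIntegrable u volume a b)
    (hu2 : IntervalIntegrable (fun θ => ‖u θ‖ ^ 2) volume a b) :
    ∫ θ in a..b, ‖u θ - c‖ ^ 2 =
      (∫ θ in a..b, ‖u θ - (b - a)⁻¹ • ∫ t in a..b, u t‖ ^ 2) +
        (b - a) * ‖(b - a)⁻¹ • (∫ t in a..b, u t) - c‖ ^ 2 := by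
  have h : ∀ c, ∫ θ in a..b, ‖u θ - c‖ ^ 2 = (∫ θ in a..b, ‖u θ‖ ^ 2) -
      2 * (starRingEnd ℂ c * ∫ θ in a..b, u θ).re + ‖c‖ ^ 2 * (b - a) := by
    intro c
    simpa using integral_mul_sq_norm_sub (p := fun _ => 1) c (by simp) (by simpa using hu)
      (by simpa using hu2)
  set m := (b - a)⁻¹ • ∫ t in a..b, u t
  have hm : ∫ t in a..b, u t = (b - a) • m := by
    rw [smul_inv_smul₀ (sub_pos.mpr hab).ne']
  rw [h, h m, hm]
  simp only [← Complex.normSq_eq_norm_sq, Complex.normSq_apply, Complex.sub_re, Complex.sub_im,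
    Complex.mul_re, Complex.conj_re, Complex.conj_im, Complex.smul_re, Complex.smul_im, smul_eq_mul]
  ring

/-- The mean oscillation of `u` over intervals of length at most `2π` is at most `B`. -/
def HasOscillationBound (u : ℝ → ℂ) (B : ℝ) : Prop :=
  ∀ a b : ℝ, a < b → b - a ≤ 2 * Real.pi →
    ∫ θ in a..b, ‖u θ - (b - a)⁻¹ • ∫ t in a..b, u t‖ ^ 2 ≤ (b - a) * B ^ 2

section Dyadic

variable {u : ℝ → ℂ} {B α η : ℝ} {N : ℕ}

theorem intervalIntegrable_sq_norm_sub (hu : ∀ a b, IntervalIntegrable u volume a b)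
    (hu2 : ∀ a b, IntervalIntegrable (fun θ => ‖u θ‖ ^ 2) volume a b) (m : ℂ) (a b : ℝ) :
    IntervalIntegrable (fun θ => ‖u θ - m‖ ^ 2) volume a b := by
  have e : ∀ θ, ‖u θ - m‖ ^ 2 =
      ‖u θ‖ ^ 2 - 2 * Complex.reCLM (starRingEnd ℂ m * u θ) + ‖m‖ ^ 2 := by
    intro θ
    rw [← Complex.normSq_eq_norm_sq, ← Complex.normSq_eq_norm_sq, ← Complex.normSq_eq_norm_sq,
      Complex.normSq_sub]
    simp [Complex.normSq_apply]
    ring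
  simp only [e]
  have h := (hu a b).const_mul (starRingEnd ℂ m)
  have h' : IntervalIntegrable (fun θ => Complex.reCLM (starRingEnd ℂ m * u θ)) volume a b :=
    ⟨Complex.reCLM.integrable_comp h.1, Complex.reCLM.integrable_comp h.2⟩
  exact ((hu2 a b).sub (h'.const_mul 2)).add intervalIntegrable_const

theorem norm_average_sub_average_le (hB : 0 ≤ B) (hu : ∀ a b, IntervalIntegrable u volume a b)
    (hu2 : ∀ a b, IntervalIntegrable (fun θ => ‖u θ‖ ^ 2) volume a b)
    (hosc : HasOscillationBound u B) {t : ℝ} (ht : 0 < t) (htπ : 2 * t ≤ Real.pi) :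
    ‖(α + t - (α - t))⁻¹ • (∫ θ in (α - t)..(α + t), u θ) -
      (α + 2 * t - (α - 2 * t))⁻¹ • (∫ θ in (α - 2 * t)..(α + 2 * t), u θ)‖ ≤ 2 * B := by
  set m := (α + 2 * t - (α - 2 * t))⁻¹ • (∫ θ in (α - 2 * t)..(α + 2 * t), u θ)
  have h1 := integral_sq_norm_sub_eq_add (show α - t < α + t by linarith) m (hu _ _) (hu2 _ _)
  have h2 := hosc (α - 2 * t) (α + 2 * t) (by linarith) (by linarith)
  have hm := intervalIntegrable_sq_norm_sub hu hu2 m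
  have h3 : ∫ θ in (α - t)..(α + t), ‖u θ - m‖ ^ 2 ≤
      ∫ θ in (α - 2 * t)..(α + 2 * t), ‖u θ - m‖ ^ 2 :=
    intervalIntegral.integral_mono_interval (by linarith) (by linarith) (by linarith)
      (Eventually.of_forall fun θ => by positivity) (hm _ _)
  have h4 : 0 ≤ ∫ θ in (α - t)..(α + t),
      ‖u θ - (α + t - (α - t))⁻¹ • ∫ t in (α - t)..(α + t), u t‖ ^ 2 :=
    intervalIntegral.integral_nonneg (by linarith) fun θ _ => by positivity
  have h5 : ‖(α + t - (α - t))⁻¹ • (∫ θ in (α - t)..(α + t), u θ) - m‖ ^ 2 ≤ 2 * B ^ 2 := by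
    have : 2 * t * ‖(α + t - (α - t))⁻¹ • (∫ θ in (α - t)..(α + t), u θ) - m‖ ^ 2 ≤
        2 * t * (2 * B ^ 2) := by linarith
    exact le_of_mul_le_mul_left this (by linarith)
  refine abs_le_of_sq_le_sq' (a := _) (b := 2 * B) ?_ (by linarith) |>.2
  nlinarith [sq_nonneg B]

theorem integral_sq_norm_sub_dyadic_le (hB : 0 ≤ B) (hη : 0 < η) (hN : η * 2 ^ N = Real.pi)
    (hu : ∀ a b, IntervalIntegrable u volume a b)
    (hu2 : ∀ a b, IntervalIntegrable (fun θ => ‖u θ‖ ^ 2) volume a b)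
    (hosc : HasOscillationBound u B) {j : ℕ} (hj : j ≤ N) :
    ∫ θ in (α - η * 2 ^ j)..(α + η * 2 ^ j),
        ‖u θ - (α + η - (α - η))⁻¹ • ∫ θ in (α - η)..(α + η), u θ‖ ^ 2 ≤
      2 * (η * 2 ^ j) * (B ^ 2 * (1 + 4 * (j : ℝ) ^ 2)) := by
  set m : ℝ → ℂ := fun t => (α + t - (α - t))⁻¹ • ∫ θ in (α - t)..(α + t), u θ
  have hle : ∀ j ≤ N, η * 2 ^ j ≤ Real.pi := fun j hj => by
    rw [← hN]
    gcongr
    norm_num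
  have hmean : ∀ j ≤ N, ‖m (η * 2 ^ j) - m η‖ ≤ 2 * B * j := by
    intro j
    induction j with
    | zero => intro _; simp
    | succ j ih =>
      intro hj
      have h1 := ih (by omega)
      have h2 := norm_average_sub_average_le (α := α) hB hu hu2 hosc (t := η * 2 ^ j)
        (by positivity) (by rw [mul_left_comm, ← pow_succ']; exact hle _ hj)
      rw [mul_left_comm, ← pow_succ'] at h2
      change ‖m (η * 2 ^ j) - m (η * 2 ^ (j + 1))‖ ≤ _ at h2
      have h3 : m (η * 2 ^ (j + 1)) - m η =
        (m (η * 2 ^ j) - m η) - (m (η * 2 ^ j) - m (η * 2 ^ (j + 1))) := by ring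
      rw [h3]
      refine (norm_sub_le _ _).trans ?_
      push_cast
      linarith
  have ht : 0 < η * 2 ^ j := by positivity
  rw [integral_sq_norm_sub_eq_add (by linarith) _ (hu _ _) (hu2 _ _)]
  have h1 := hosc (α - η * 2 ^ j) (α + η * 2 ^ j) (by linarith) (by linarith [hle j hj])
  have h2 : ‖m (η * 2 ^ j) - m η‖ ^ 2 ≤ (2 * B * j) ^ 2 := by
    gcongr
    exact hmean j hj
  change _ + _ * ‖m (η * 2 ^ j) - m η‖ ^ 2 ≤ _
  have h3 : α + η * 2 ^ j - (α - η * 2 ^ j) = 2 * (η * 2 ^ j) := by ring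
  rw [h3] at h1 ⊢
  have h4 := mul_le_mul_of_nonneg_left h2 (show 0 ≤ 2 * (η * 2 ^ j) by positivity)
  calc _ ≤ 2 * (η * 2 ^ j) * B ^ 2 + 2 * (η * 2 ^ j) * (2 * B * j) ^ 2 := add_le_add h1 h4
    _ = _ := by ring

/-- A Poisson-type kernel integrates the squared deviation from a suitable constant to a bounded
multiple of the squared mean oscillation. -/
theorem exists_integral_mul_sq_norm_sub_le {P : ℝ → ℝ} {A : ℝ} (hB : 0 ≤ B) (hη : 0 < η)
    (hA : 0 ≤ A) (hN : η * 2 ^ N = Real.pi) (hPc : Continuous P) (hP0 : ∀ θ, 0 ≤ P θ)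
    (hP1 : ∀ θ, P θ ≤ A / η)
    (hP2 : ∀ θ, |θ - α| ≤ Real.pi → P θ * (θ - α) ^ 2 ≤ A * η)
    (hu : ∀ a b, IntervalIntegrable u volume a b)
    (hu2 : ∀ a b, IntervalIntegrable (fun θ => ‖u θ‖ ^ 2) volume a b)
    (hosc : HasOscillationBound u B) :
    ∃ c : ℂ, ∫ θ in (α - Real.pi)..(α + Real.pi), P θ * ‖u θ - c‖ ^ 2 ≤ 202 * A * B ^ 2 := by
  set c := (α + η - (α - η))⁻¹ • ∫ θ in (α - η)..(α + η), u θ with hc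
  refine ⟨c, ?_⟩
  have hW := intervalIntegrable_sq_norm_sub hu hu2 c
  have hPW : ∀ a b, IntervalIntegrable (fun θ => P θ * ‖u θ - c‖ ^ 2) volume a b :=
    fun a b => (hW a b).continuousOn_mul hPc.continuousOn
  have hdy : ∀ j ≤ N, ∫ θ in (α - η * 2 ^ j)..(α + η * 2 ^ j), ‖u θ - c‖ ^ 2 ≤
      2 * (η * 2 ^ j) * (B ^ 2 * (1 + 4 * (j : ℝ) ^ 2)) := fun j hj =>
    integral_sq_norm_sub_dyadic_le hB hη hN hu hu2 hosc hj
  have hle : ∀ j ≤ N, η * 2 ^ j ≤ Real.pi := fun j hj => by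
    rw [← hN]
    gcongr
    norm_num
  have hind : ∀ j ≤ N, ∫ θ in (α - η * 2 ^ j)..(α + η * 2 ^ j), P θ * ‖u θ - c‖ ^ 2 ≤
      A * B ^ 2 * (2 + 4 * (50 - (8 * (j : ℝ) ^ 2 + 32 * j + 50) / 2 ^ j)) := by
    intro j
    induction j with
    | zero =>
      intro hj
      have h0 := hdy 0 hj
      simp only [pow_zero, mul_one, Nat.cast_zero] at h0 ⊢
      calc _ ≤ ∫ θ in (α - η)..(α + η), A / η * ‖u θ - c‖ ^ 2 :=
            intervalIntegral.integral_mono_on (by linarith) (hPW _ _) ((hW _ _).const_mul _)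
              fun θ _ => mul_le_mul_of_nonneg_right (hP1 θ) (by positivity)
        _ = A / η * ∫ θ in (α - η)..(α + η), ‖u θ - c‖ ^ 2 :=
            intervalIntegral.integral_const_mul _ _
        _ ≤ A / η * (2 * η * (B ^ 2 * (1 + 4 * 0 ^ 2))) := by gcongr
        _ = _ := by
          field_simp
          ring
    | succ j ih =>
      intro hj
      have h1 := ih (by omega)
      have h2 := hdy (j + 1) hj
      set t := η * 2 ^ j with ht
      have ht0 : 0 < t := by positivity
      have ht2 : η * 2 ^ (j + 1) = 2 * t := by rw [ht, pow_succ]; ring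
      have htπ := hle (j + 1) hj
      rw [ht2] at h2 htπ ⊢
      have hout : ∀ a b, a ≤ b → (∀ θ ∈ Set.Icc a b, t ≤ |θ - α| ∧ |θ - α| ≤ Real.pi) →
          ∫ θ in a..b, P θ * ‖u θ - c‖ ^ 2 ≤
            A * η / t ^ 2 * ∫ θ in a..b, ‖u θ - c‖ ^ 2 := by
        intro a b hab h
        rw [← intervalIntegral.integral_const_mul]
        refine intervalIntegral.integral_mono_on hab (hPW _ _) ((hW _ _).const_mul _) fun θ hθ => ?_
        refine mul_le_mul_of_nonneg_right ?_ (by positivity)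
        rw [le_div_iff₀ (by positivity)]
        refine le_trans ?_ (hP2 θ (h θ hθ).2)
        refine mul_le_mul_of_nonneg_left ?_ (hP0 θ)
        rw [← sq_abs (θ - α)]
        exact pow_le_pow_left₀ ht0.le (h θ hθ).1 2
      have hl := hout (α - 2 * t) (α - t) (by linarith) fun θ hθ => by
        rw [abs_of_nonpos (by linarith [hθ.2])]
        exact ⟨by linarith [hθ.2], by linarith [hθ.1]⟩
      have hr := hout (α + t) (α + 2 * t) (by linarith) fun θ hθ => by
        rw [abs_of_nonneg (by linarith [hθ.1])]
        exact ⟨by linarith [hθ.1], by linarith [hθ.2]⟩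
      have hsplit : ∀ φ : ℝ → ℝ, (∀ a b, IntervalIntegrable φ volume a b) →
          ∫ θ in (α - 2 * t)..(α + 2 * t), φ θ = (∫ θ in (α - 2 * t)..(α - t), φ θ) +
            (∫ θ in (α - t)..(α + t), φ θ) + ∫ θ in (α + t)..(α + 2 * t), φ θ := by
        intro φ hφ
        rw [intervalIntegral.integral_add_adjacent_intervals (hφ _ _) (hφ _ _),
          intervalIntegral.integral_add_adjacent_intervals (hφ _ _) (hφ _ _)]
      rw [hsplit _ hPW]
      rw [hsplit _ hW] at h2
      have hmid : 0 ≤ ∫ θ in (α - t)..(α + t), ‖u θ - c‖ ^ 2 :=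
        intervalIntegral.integral_nonneg (by linarith) fun θ _ => by positivity
      have hstep : A * η / t ^ 2 * (2 * (2 * t) * (B ^ 2 * (1 + 4 * ((j + 1 : ℕ) : ℝ) ^ 2))) =
          A * B ^ 2 * (4 * (1 + 4 * ((j + 1 : ℕ) : ℝ) ^ 2) / 2 ^ j) := by
        rw [ht]
        field_simp
        ring
      have hq : 0 ≤ A * η / t ^ 2 := by positivity
      have h3 := mul_le_mul_of_nonneg_left h2 hq
      have h4 := mul_nonneg hq hmid
      have hfin : A * B ^ 2 * (2 + 4 * (50 - (8 * (j : ℝ) ^ 2 + 32 * j + 50) / 2 ^ j)) +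
          A * B ^ 2 * (4 * (1 + 4 * ((j + 1 : ℕ) : ℝ) ^ 2) / 2 ^ j) =
          A * B ^ 2 * (2 + 4 * (50 - (8 * ((j + 1 : ℕ) : ℝ) ^ 2 + 32 * (j + 1 : ℕ) + 50) /
            2 ^ (j + 1))) := by
        rw [pow_succ]
        push_cast
        field_simp
        ring
      rw [← hfin, ← hstep]
      linarith
  have hfinal := hind N le_rfl
  rw [hN] at hfinal
  refine hfinal.trans ?_
  have h1 : 0 ≤ (8 * (N : ℝ) ^ 2 + 32 * N + 50) / 2 ^ N := by positivity
  have h2 : 0 ≤ A * B ^ 2 := by positivity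
  nlinarith

end Dyadic

section PoissonKernel

variable {z : ℂ}

theorem norm_circleMap_sub_ge (z : ℂ) (θ : ℝ) : 1 - ‖z‖ ≤ ‖circleMap 0 1 θ - z‖ := by
  have := norm_sub_norm_le (circleMap 0 1 θ) z
  simpa using this

theorem poissonKernel_circleMap_eq (z : ℂ) (θ : ℝ) :
    poissonKernel 0 z (circleMap 0 1 θ) = (1 - ‖z‖ ^ 2) / ‖circleMap 0 1 θ - z‖ ^ 2 := by
  simp [poissonKernel]

theorem poissonKernel_circleMap_nonneg (hz : ‖z‖ < 1) (θ : ℝ) :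
    0 ≤ poissonKernel 0 z (circleMap 0 1 θ) := by
  rw [poissonKernel_circleMap_eq]
  have : 0 ≤ 1 - ‖z‖ ^ 2 := by nlinarith [norm_nonneg z]
  positivity

theorem poissonKernel_circleMap_le (hz : ‖z‖ < 1) (θ : ℝ) :
    poissonKernel 0 z (circleMap 0 1 θ) ≤ 2 / (1 - ‖z‖) := by
  have h := norm_circleMap_sub_ge z θ
  have hδ : 0 < 1 - ‖z‖ := by linarith
  have hd := hδ.trans_le h
  rw [poissonKernel_circleMap_eq, div_le_div_iff₀ (by positivity) hδ]
  have h2 : (1 - ‖z‖) ^ 2 ≤ ‖circleMap 0 1 θ - z‖ ^ 2 := by gcongr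
  nlinarith [norm_nonneg z]

theorem abs_sub_le_pi_mul_norm_sub (hz : ‖z‖ < 1) {θ : ℝ} (hθ : |θ - z.arg| ≤ Real.pi) :
    |θ - z.arg| ≤ Real.pi * ‖circleMap 0 1 θ - z‖ := by
  have h1 : ‖circleMap 0 1 θ - circleMap 0 1 z.arg‖ = ‖2 * Real.sin ((θ - z.arg) / 2)‖ := by
    rw [← Complex.norm_exp_I_mul_ofReal_sub_one]
    have : circleMap 0 1 θ - circleMap 0 1 z.arg =
        circleMap 0 1 z.arg * (Complex.exp (Complex.I * ((θ - z.arg : ℝ) : ℂ)) - 1) := by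
      simp only [circleMap, mul_sub, mul_one, zero_add, Complex.ofReal_one, one_mul,
        ← Complex.exp_add]
      congr 2
      push_cast
      ring
    rw [this, norm_mul]
    simp
  have h2 : 2 / Real.pi * |(θ - z.arg) / 2| ≤ |Real.sin ((θ - z.arg) / 2)| := by
    refine Real.mul_abs_le_abs_sin ?_
    rw [abs_div, abs_two]
    linarith
  have h3 : ‖circleMap 0 1 z.arg - z‖ = 1 - ‖z‖ := by
    have : circleMap 0 1 z.arg - z = (1 - ‖z‖ : ℝ) * circleMap 0 1 z.arg := by
      simp only [circleMap, zero_add, Complex.ofReal_one, one_mul, Complex.ofReal_sub]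
      linear_combination Complex.norm_mul_exp_arg_mul_I z
    rw [this, norm_mul, Complex.norm_real, Real.norm_of_nonneg (by linarith)]
    simp
  have h4 : ‖circleMap 0 1 θ - circleMap 0 1 z.arg‖ ≤ 2 * ‖circleMap 0 1 θ - z‖ := by
    have h5 := norm_sub_le_norm_sub_add_norm_sub (circleMap 0 1 θ) z (circleMap 0 1 z.arg)
    rw [norm_sub_rev z, h3] at h5
    linarith [norm_circleMap_sub_ge z θ]
  rw [h1, norm_mul, Real.norm_eq_abs, Real.norm_eq_abs, abs_two] at h4
  rw [abs_div, abs_two, div_mul_div_comm, div_le_iff₀ (by positivity)] at h2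
  nlinarith [Real.pi_pos]

theorem poissonKernel_circleMap_mul_sq_le (hz : ‖z‖ < 1) {θ : ℝ} (hθ : |θ - z.arg| ≤ Real.pi) :
    poissonKernel 0 z (circleMap 0 1 θ) * (θ - z.arg) ^ 2 ≤ 2 * Real.pi ^ 2 * (1 - ‖z‖) := by
  have h := abs_sub_le_pi_mul_norm_sub hz hθ
  have hδ : 0 < 1 - ‖z‖ := by linarith
  have hd : 0 < ‖circleMap 0 1 θ - z‖ := hδ.trans_le (norm_circleMap_sub_ge z θ)
  rw [poissonKernel_circleMap_eq, div_mul_eq_mul_div, div_le_iff₀ (by positivity)]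
  have h2 : (θ - z.arg) ^ 2 ≤ (Real.pi * ‖circleMap 0 1 θ - z‖) ^ 2 := by
    rw [← sq_abs]
    gcongr
  have h3 : 1 - ‖z‖ ^ 2 ≤ 2 * (1 - ‖z‖) := by nlinarith [norm_nonneg z]
  calc (1 - ‖z‖ ^ 2) * (θ - z.arg) ^ 2
      ≤ 2 * (1 - ‖z‖) * (Real.pi * ‖circleMap 0 1 θ - z‖) ^ 2 := by gcongr
    _ = _ := by ring

end PoissonKernel

section Garsia

variable {c : ℕ → ℂ} {G : ℂ → ℂ} {z : ℂ}

theorem circleMap_comp_periodic {E : Type*} (φ : ℂ → E) :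
    Function.Periodic (fun θ => φ (circleMap 0 1 θ)) (2 * Real.pi) := fun θ => by
  simp only [periodic_circleMap 0 1 θ]

theorem IsRadialLimit.intervalIntegrable (hG : IsRadialLimit c G)
    (hc : Summable fun n => ‖c n‖ ^ 2) (a b : ℝ) :
    IntervalIntegrable (fun θ => G (circleMap 0 1 θ)) volume a b := by
  refine (circleMap_comp_periodic G).intervalIntegrable Real.two_pi_pos.ne' (t := 0) ?_ a b
  rw [zero_add, intervalIntegrable_iff_integrableOn_Ioc_of_le Real.two_pi_pos.le]
  exact (hG.memLp hc).integrable one_le_two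

theorem IsRadialLimit.intervalIntegrable_sq (hG : IsRadialLimit c G)
    (hc : Summable fun n => ‖c n‖ ^ 2) (a b : ℝ) :
    IntervalIntegrable (fun θ => ‖G (circleMap 0 1 θ)‖ ^ 2) volume a b := by
  refine (circleMap_comp_periodic (fun w => ‖G w‖ ^ 2)).intervalIntegrable
    Real.two_pi_pos.ne' (t := 0) ?_ a b
  rw [zero_add, intervalIntegrable_iff_integrableOn_Ioc_of_le Real.two_pi_pos.le]
  exact (memLp_two_iff_integrable_sq_norm (hG.memLp hc).1).mp (hG.memLp hc)

/-- The holomorphic function whose real part is the Poisson extension of `‖G‖²`. -/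
noncomputable def herglotzSq (G : ℂ → ℂ) (z : ℂ) : ℂ :=
  Real.circleAverage (fun ζ => herglotzRieszKernel 0 z ζ • ((‖G ζ‖ ^ 2 : ℝ) : ℂ)) 0 1

theorem differentiableOn_herglotzSq (hG : IsRadialLimit c G) (hc : Summable fun n => ‖c n‖ ^ 2) :
    DifferentiableOn ℂ (herglotzSq G) (Metric.ball 0 1) := by
  refine differentiableOn_circleAverage_herglotzRieszKernel_smul ?_
  have h := hG.intervalIntegrable_sq hc 0 (2 * Real.pi)
  exact ⟨h.1.ofReal, h.2.ofReal⟩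

theorem circleAverage_poissonKernel_mul_sq_norm_sub (hG : IsRadialLimit c G)
    (hc : Summable fun n => ‖c n‖ ^ 2) (hz : z ∈ Metric.ball (0 : ℂ) 1) (m : ℂ) :
    Real.circleAverage (fun ζ => poissonKernel 0 z ζ * ‖G ζ - m‖ ^ 2) 0 1 =
      (herglotzSq G z).re - ‖powerSum c z‖ ^ 2 + ‖powerSum c z - m‖ ^ 2 := by
  have hP := continuous_poissonKernel_circleMap hz
  have hu := hG.intervalIntegrable hc 0 (2 * Real.pi)
  have hu2 := hG.intervalIntegrable_sq hc 0 (2 * Real.pi)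
  have h := integral_mul_sq_norm_sub (u := fun θ => G (circleMap 0 1 θ)) m
    (hP.intervalIntegrable 0 (2 * Real.pi))
    (hu.continuousOn_mul (Complex.continuous_ofReal.comp hP).continuousOn)
    (hu2.continuousOn_mul hP.continuousOn)
  have h1 : ∫ θ in (0 : ℝ)..(2 * Real.pi), poissonKernel 0 z (circleMap 0 1 θ) *
      ‖G (circleMap 0 1 θ)‖ ^ 2 = 2 * Real.pi * (herglotzSq G z).re := by
    rw [herglotzSq, re_circleAverage_herglotzRieszKernel_smul (g := fun ζ => ‖G ζ‖ ^ 2) hu2 hz,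
      ← poissonKernel_eq_re_herglotzRieszKernel, Real.circleAverage_def, smul_eq_mul,
      mul_inv_cancel_left₀ Real.two_pi_pos.ne']
    rfl
  have h2 : ∫ θ in (0 : ℝ)..(2 * Real.pi), (poissonKernel 0 z (circleMap 0 1 θ) : ℂ) *
      G (circleMap 0 1 θ) = (2 * Real.pi) • powerSum c z := by
    rw [powerSum_eq_circleAverage_poissonKernel hG hc hz, Real.circleAverage_def,
      smul_inv_smul₀ Real.two_pi_pos.ne']
    simp
  have h3 : ∫ θ in (0 : ℝ)..(2 * Real.pi), poissonKernel 0 z (circleMap 0 1 θ) =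
      2 * Real.pi := by
    have h4 := (diffContOnCl_const (c := (1 : ℂ))
      (s := Metric.ball (0 : ℂ) 1)).circleAverage_poissonKernel_smul hz
    rw [Real.circleAverage_def, inv_smul_eq_iff₀ Real.two_pi_pos.ne'] at h4
    simp only [Pi.smul_apply', Complex.real_smul, mul_one, intervalIntegral.integral_ofReal] at h4
    exact_mod_cast h4
  rw [h1, h2, h3] at h
  rw [Real.circleAverage_def, h, smul_eq_mul, inv_mul_eq_iff_eq_mul₀ Real.two_pi_pos.ne']
  simp only [← Complex.normSq_eq_norm_sq, Complex.normSq_apply, Complex.sub_re, Complex.sub_im,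
    Complex.mul_re, Complex.conj_re, Complex.conj_im, Complex.smul_re, Complex.smul_im, smul_eq_mul]
  ring

theorem sq_norm_powerSum_sub_herglotzSq_nonpos (hG : IsRadialLimit c G)
    (hc : Summable fun n => ‖c n‖ ^ 2) (hz : z ∈ Metric.ball (0 : ℂ) 1) :
    ‖powerSum c z‖ ^ 2 - (herglotzSq G z).re ≤ 0 := by
  have h := circleAverage_poissonKernel_mul_sq_norm_sub hG hc hz (powerSum c z)
  have h0 : 0 ≤ Real.circleAverage
      (fun ζ => poissonKernel 0 z ζ * ‖G ζ - powerSum c z‖ ^ 2) 0 1 := by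
    rw [Real.circleAverage_def]
    refine smul_nonneg (by positivity) (intervalIntegral.integral_nonneg Real.two_pi_pos.le ?_)
    intro θ _
    exact mul_nonneg (poissonKernel_circleMap_nonneg (by simpa using hz) θ) (by positivity)
  rw [sub_self, norm_zero] at h
  linarith

/-- Bounded mean oscillation bounds the Garsia norm of the Poisson extension. -/
theorem neg_le_sq_norm_powerSum_sub_herglotzSq {B : ℝ} (hG : IsRadialLimit c G)
    (hc : Summable fun n => ‖c n‖ ^ 2) (hB : 0 ≤ B)
    (hosc : HasOscillationBound (fun θ => G (circleMap 0 1 θ)) B)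
    (hz : z ∈ Metric.ball (0 : ℂ) 1) :
    -(404 * B ^ 2) ≤ ‖powerSum c z‖ ^ 2 - (herglotzSq G z).re := by
  have hz1 : ‖z‖ < 1 := by simpa using hz
  have hδ : 0 < 1 - ‖z‖ := by linarith
  obtain ⟨N, hN1, hN2⟩ := exists_nat_pow_near_of_lt_one hδ (by linarith [norm_nonneg z])
    (show (0 : ℝ) < 1 / 2 by norm_num) (by norm_num)
  have hpow : (1 / 2 : ℝ) ^ N * 2 ^ N = 1 := by rw [← mul_pow]; norm_num
  obtain ⟨m, hm⟩ := exists_integral_mul_sq_norm_sub_le (u := fun θ => G (circleMap 0 1 θ))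
    (P := fun θ => poissonKernel 0 z (circleMap 0 1 θ)) (α := z.arg) (N := N)
    (η := Real.pi * (1 / 2) ^ N) (A := 4 * Real.pi) hB (by positivity) (by positivity)
    (by rw [mul_assoc, hpow, mul_one])
    (continuous_poissonKernel_circleMap hz) (poissonKernel_circleMap_nonneg hz1)
    (fun θ => by
      refine (poissonKernel_circleMap_le hz1 θ).trans ?_
      rw [pow_succ] at hN1
      rw [div_le_div_iff₀ hδ (by positivity)]
      nlinarith [Real.pi_pos])
    (fun θ hθ => by
      refine (poissonKernel_circleMap_mul_sq_le hz1 hθ).trans ?_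
      have h : Real.pi ^ 2 * (1 - ‖z‖) ≤ Real.pi ^ 2 * (1 / 2) ^ N := by gcongr
      nlinarith [show 0 ≤ Real.pi ^ 2 * (1 / 2) ^ N by positivity])
    (hG.intervalIntegrable hc) (hG.intervalIntegrable_sq hc) hosc
  have h := circleAverage_poissonKernel_mul_sq_norm_sub hG hc hz m
  have hper := (circleMap_comp_periodic fun ζ => poissonKernel 0 z ζ *
    ‖G ζ - m‖ ^ 2).intervalIntegral_add_eq 0 (z.arg - Real.pi)
  rw [zero_add, show z.arg - Real.pi + 2 * Real.pi = z.arg + Real.pi by ring] at hper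
  rw [Real.circleAverage_def, hper, smul_eq_mul, inv_mul_eq_iff_eq_mul₀ Real.two_pi_pos.ne'] at h
  rw [h] at hm
  have h5 : (herglotzSq G z).re - ‖powerSum c z‖ ^ 2 + ‖powerSum c z - m‖ ^ 2 ≤ 404 * B ^ 2 := by
    refine le_of_mul_le_mul_left (hm.trans (le_of_eq ?_)) Real.two_pi_pos
    ring
  linarith [sq_nonneg ‖powerSum c z - m‖]

end Garsia

theorem norm_apply_zero_le_circleAverage {f : ℂ → ℂ} {s : ℝ} (hs : 0 ≤ s) (hs1 : s < 1)
    (hf : DifferentiableOn ℂ f (Metric.ball 0 1)) :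
    ‖f 0‖ ≤ Real.circleAverage (fun z => ‖f z‖) 0 s := by
  have hd : DiffContOnCl ℂ f (Metric.ball 0 |s|) := by
    rw [abs_of_nonneg hs]
    exact (hf.mono ((closure_mono Metric.ball_subset_closedBall).trans (by
      rw [Metric.isClosed_closedBall.closure_eq]
      exact Metric.closedBall_subset_ball hs1))).diffContOnCl
  rw [← hd.circleAverage, Real.circleAverage_def, Real.circleAverage_def, norm_smul,
    Real.norm_of_nonneg (by positivity), smul_eq_mul]
  gcongr
  exact intervalIntegral.norm_integral_le_integral_norm Real.two_pi_pos.le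

/-- Fefferman's inequality for power series with complex coefficients. -/
theorem norm_tsum_conj_mul_le {c f : ℕ → ℂ} {G : ℂ → ℂ} {B M r : ℝ}
    (hc : Summable fun n => ‖c n‖ ^ 2) (hG : IsRadialLimit c G) (hB : 0 ≤ B)
    (hosc : HasOscillationBound (fun θ => G (circleMap 0 1 θ)) B)
    (hf : ∀ r : ℝ, 0 ≤ r → r < 1 → Summable fun n => r ^ n * ‖f n‖)
    (hM : ∀ s : ℝ, 0 < s → s < 1 → Real.circleAverage (fun z => ‖powerSum f z‖) 0 s ≤ M)
    (hr : 0 < r) (hr1 : r < 1) :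
    ‖∑' n, (r : ℂ) ^ n * (starRingEnd ℂ (c n) * f n)‖ ≤ 84 * (B + ‖c 0‖) * M := by
  have hs0 : 0 < √r := Real.sqrt_pos.mpr hr
  have hs1 : √r < 1 := by rwa [Real.sqrt_lt' one_pos, one_pow]
  have hcs := summable_pow_mul_norm_of_sq hc
  have hdf := differentiableOn_powerSum hf
  have hsum := (circleAverage_conj_powerSum_mul hs0.le (hcs _ hs0.le hs1)
    (hf _ hs0.le hs1)).tsum_eq
  have hpow : ∀ n : ℕ, ((√r : ℝ) : ℂ) ^ (2 * n) = (r : ℂ) ^ n := fun n => by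
    rw [pow_mul, ← Complex.ofReal_pow, Real.sq_sqrt hr.le]
  simp only [hpow] at hsum
  have h0 : ∀ a : ℕ → ℂ, powerSum a 0 = a 0 := fun a => by
    rw [powerSum, tsum_eq_single 0 (fun n hn => by simp [hn])]
    simp
  have hf0 : ‖f 0‖ ≤ M := by
    rw [← h0 f]
    exact (norm_apply_zero_le_circleAverage hs0.le hs1 hdf).trans (hM _ hs0 hs1)
  have hM0 : 0 ≤ M := (norm_nonneg _).trans hf0
  have key : ∀ ε : ℝ, 0 < ε → ‖∑' n, (r : ℂ) ^ n * (starRingEnd ℂ (c n) * f n)‖ ≤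
      84 * (B + ε + ‖c 0‖) * M := by
    intro ε hε
    have hBε : 0 < B + ε := by linarith
    have h := norm_circleAverage_conj_mul_le (K := (21 * (B + ε)) ^ 2) hdf
      (differentiableOn_powerSum hcs) (differentiableOn_herglotzSq hG hc) (by positivity)
      (fun z hz => by
        have := neg_le_sq_norm_powerSum_sub_herglotzSq hG hc hB hosc hz
        nlinarith)
      (fun z hz => sq_norm_powerSum_sub_herglotzSq_nonpos hG hc hz) hs0 hs1
    rw [← hsum, Real.sqrt_sq (by positivity), h0, h0] at h
    refine h.trans ?_
    have he : 1 + Real.exp 1 ≤ 4 := by linarith [Real.exp_one_lt_d9]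
    have h1 : 21 * (B + ε) * (1 + Real.exp 1) *
        Real.circleAverage (fun z => ‖powerSum f z‖) 0 √r ≤ 21 * (B + ε) * 4 * M :=
      mul_le_mul (by gcongr) (hM _ hs0 hs1)
        ((norm_nonneg _).trans (norm_apply_zero_le_circleAverage hs0.le hs1 hdf)) (by positivity)
    have h2 : ‖c 0‖ * ‖f 0‖ ≤ ‖c 0‖ * M := by gcongr
    nlinarith [mul_nonneg (norm_nonneg (c 0)) hM0]
  have hlim : Tendsto (fun ε : ℝ => 84 * (B + ε + ‖c 0‖) * M) (𝓝[>] 0)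
      (𝓝 (84 * (B + 0 + ‖c 0‖) * M)) := by
    have : Continuous fun ε : ℝ => 84 * (B + ε + ‖c 0‖) * M := by fun_prop
    exact (this.tendsto 0).mono_left nhdsWithin_le_nhds
  rw [add_zero] at hlim
  exact ge_of_tendsto hlim (eventually_mem_nhdsWithin.mono fun ε hε => key ε hε)

section Quaternion

/-- The first complex component `α` of a quaternion `α + β j`. -/
noncomputable def complexFst : ℍ[ℝ] →L[ℝ] ℂ :=
  LinearMap.toContinuousLinearMap
    { toFun := fun q => ⟨q.re, q.imI⟩
      map_add' := fun _ _ => rfl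
      map_smul' := fun r q => by apply Complex.ext <;> simp }

/-- The second complex component `β` of a quaternion `α + β j`. -/
noncomputable def complexSnd : ℍ[ℝ] →L[ℝ] ℂ :=
  LinearMap.toContinuousLinearMap
    { toFun := fun q => ⟨q.imJ, q.imK⟩
      map_add' := fun _ _ => rfl
      map_smul' := fun r q => by apply Complex.ext <;> simp }

/-- The quaternion `α + β j` with complex components `α` and `β`. -/
noncomputable def quaternionMk : ℂ × ℂ →L[ℝ] ℍ[ℝ] :=
  LinearMap.toContinuousLinearMap
    { toFun := fun p => ⟨p.1.re, p.1.im, p.2.re, p.2.im⟩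
      map_add' := fun _ _ => rfl
      map_smul' := fun r p => by ext <;> simp <;> rfl }

theorem complexFst_apply (q : ℍ[ℝ]) : complexFst q = ⟨q.re, q.imI⟩ := rfl

theorem complexSnd_apply (q : ℍ[ℝ]) : complexSnd q = ⟨q.imJ, q.imK⟩ := rfl

theorem quaternionMk_components (q : ℍ[ℝ]) :
    quaternionMk (complexFst q, complexSnd q) = q := rfl

theorem sq_norm_eq_components (q : ℍ[ℝ]) :
    ‖q‖ ^ 2 = ‖complexFst q‖ ^ 2 + ‖complexSnd q‖ ^ 2 := by
  rw [sq ‖q‖, ← Quaternion.normSq_eq_norm_mul_self, Quaternion.normSq_def',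
    ← Complex.normSq_eq_norm_sq, ← Complex.normSq_eq_norm_sq, complexFst_apply, complexSnd_apply,
    Complex.normSq_mk, Complex.normSq_mk]
  ring

theorem norm_complexFst_le (q : ℍ[ℝ]) : ‖complexFst q‖ ≤ ‖q‖ := by
  rw [← pow_le_pow_iff_left₀ (norm_nonneg _) (norm_nonneg _) two_ne_zero, sq_norm_eq_components]
  exact le_add_of_nonneg_right (sq_nonneg _)

theorem norm_complexSnd_le (q : ℍ[ℝ]) : ‖complexSnd q‖ ≤ ‖q‖ := by
  rw [← pow_le_pow_iff_left₀ (norm_nonneg _) (norm_nonneg _) two_ne_zero, sq_norm_eq_components]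
  exact le_add_of_nonneg_left (sq_nonneg _)

theorem norm_le_norm_components (q : ℍ[ℝ]) : ‖q‖ ≤ ‖complexFst q‖ + ‖complexSnd q‖ := by
  rw [← pow_le_pow_iff_left₀ (norm_nonneg _) (by positivity) two_ne_zero, sq_norm_eq_components]
  nlinarith [norm_nonneg (complexFst q), norm_nonneg (complexSnd q)]

theorem norm_quaternion_ofComplex (w : ℂ) : ‖Quaternion.ofComplex w‖ = ‖w‖ := by
  have h1 : complexFst (Quaternion.ofComplex w) = w := by
    apply Complex.ext <;> simp [complexFst_apply]
  have h2 : complexSnd (Quaternion.ofComplex w) = 0 := by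
    apply Complex.ext <;> simp [complexSnd_apply]
  rw [← pow_left_inj₀ (norm_nonneg _) (norm_nonneg _) two_ne_zero, sq_norm_eq_components, h1, h2]
  simp

theorem complexFst_ofComplex_mul (w : ℂ) (q : ℍ[ℝ]) :
    complexFst (Quaternion.ofComplex w * q) = w * complexFst q := by
  apply Complex.ext <;> simp [complexFst_apply]

theorem complexSnd_ofComplex_mul (w : ℂ) (q : ℍ[ℝ]) :
    complexSnd (Quaternion.ofComplex w * q) = w * complexSnd q := by
  apply Complex.ext <;> simp [complexSnd_apply]

theorem complexFst_star_mul (p q : ℍ[ℝ]) :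
    complexFst (star p * q) = starRingEnd ℂ (complexFst p) * complexFst q +
      starRingEnd ℂ (starRingEnd ℂ (complexSnd p) * complexSnd q) := by
  apply Complex.ext <;> simp [complexFst_apply, complexSnd_apply] <;> ring

theorem complexSnd_star_mul (p q : ℍ[ℝ]) :
    complexSnd (star p * q) = starRingEnd ℂ (complexFst p) * complexSnd q -
      starRingEnd ℂ (starRingEnd ℂ (complexSnd p) * complexFst q) := by
  apply Complex.ext <;> simp [complexFst_apply, complexSnd_apply] <;> ring

theorem smul_expQ_eq_ofComplex (r θ : ℝ) :
    r • expQ (Quaternion.ofComplex Complex.I) θ = Quaternion.ofComplex (circleMap 0 r θ) := by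
  have h : circleMap 0 r θ = r • (Real.cos θ • (1 : ℂ) + Real.sin θ • Complex.I) := by
    rw [circleMap_zero, Complex.exp_mul_I]
    simp [mul_add]
  rw [h, map_smul, map_add, map_smul, map_smul, map_one, expQ]

theorem summable_expQ_pow_mul {a : ℕ → ℍ[ℝ]} {r : ℝ} (hr : 0 ≤ r)
    (ha : Summable fun n => r ^ n * ‖a n‖) (θ : ℝ) :
    Summable fun n => (r • expQ (Quaternion.ofComplex Complex.I) θ) ^ n * a n := by
  refine Summable.of_norm_bounded ha fun n => ?_
  rw [smul_expQ_eq_ofComplex, norm_mul, norm_pow, norm_quaternion_ofComplex]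
  simp [abs_of_nonneg hr]

theorem map_tsum_expQ_pow_mul {a : ℕ → ℍ[ℝ]} {L : ℍ[ℝ] →L[ℝ] ℂ} {r : ℝ}
    (hLmul : ∀ (w : ℂ) (q : ℍ[ℝ]), L (Quaternion.ofComplex w * q) = w * L q) (hr : 0 ≤ r)
    (ha : Summable fun n => r ^ n * ‖a n‖) (θ : ℝ) :
    L (∑' n, (r • expQ (Quaternion.ofComplex Complex.I) θ) ^ n * a n) =
      powerSum (fun n => L (a n)) (circleMap 0 r θ) := by
  rw [L.map_tsum (summable_expQ_pow_mul hr ha θ)]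
  simp only [smul_expQ_eq_ofComplex, ← map_pow, hLmul, powerSum]

theorem tsum_expQ_pow_mul {a : ℕ → ℍ[ℝ]} {r : ℝ} (hr : 0 ≤ r)
    (ha : Summable fun n => r ^ n * ‖a n‖) (θ : ℝ) :
    ∑' n, (r • expQ (Quaternion.ofComplex Complex.I) θ) ^ n * a n =
      quaternionMk (powerSum (fun n => complexFst (a n)) (circleMap 0 r θ),
        powerSum (fun n => complexSnd (a n)) (circleMap 0 r θ)) := by
  rw [← map_tsum_expQ_pow_mul complexFst_ofComplex_mul hr ha,
    ← map_tsum_expQ_pow_mul complexSnd_ofComplex_mul hr ha, quaternionMk_components]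

theorem summable_pow_mul_norm_component {a : ℕ → ℍ[ℝ]} {L : ℍ[ℝ] →L[ℝ] ℂ}
    (hL : ∀ q, ‖L q‖ ≤ ‖q‖)
    (ha : ∀ r : ℝ, 0 ≤ r → r < 1 → Summable fun n => r ^ n * ‖a n‖) (r : ℝ) (h0 : 0 ≤ r)
    (h1 : r < 1) : Summable fun n => r ^ n * ‖L (a n)‖ :=
  Summable.of_nonneg_of_le (fun _ => by positivity)
    (fun n => mul_le_mul_of_nonneg_left (hL (a n)) (by positivity)) (ha r h0 h1)

theorem summable_sq_norm_component {b : ℕ → ℍ[ℝ]} {L : ℍ[ℝ] →L[ℝ] ℂ}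
    (hL : ∀ q, ‖L q‖ ≤ ‖q‖) (hb : Summable fun n => ‖b n‖ ^ 2) :
    Summable fun n => ‖L (b n)‖ ^ 2 :=
  Summable.of_nonneg_of_le (fun _ => by positivity)
    (fun n => pow_le_pow_left₀ (norm_nonneg _) (hL (b n)) 2) hb

theorem summable_pow_mul_norm_of_sq_quaternion {b : ℕ → ℍ[ℝ]}
    (hb : Summable fun n => ‖b n‖ ^ 2) (r : ℝ) (h0 : 0 ≤ r) (h1 : r < 1) :
    Summable fun n => r ^ n * ‖b n‖ := by
  simpa using summable_pow_mul_norm_of_sq (c := fun n => (‖b n‖ : ℂ)) (by simpa using hb) r h0 h1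

/-- The radial limit of a power series, as a function on the unit circle. -/
noncomputable def radialLimit (c : ℕ → ℂ) (ζ : ℂ) : ℂ :=
  limUnder (𝓝[<] (1 : ℝ)) fun r : ℝ => powerSum c (r * ζ)

theorem radialLimit_circleMap_eq {c : ℕ → ℂ} {θ : ℝ} {w : ℂ}
    (h : Tendsto (fun r : ℝ => powerSum c (circleMap 0 r θ)) (𝓝[<] 1) (𝓝 w)) :
    radialLimit c (circleMap 0 1 θ) = w := by
  refine Filter.Tendsto.limUnder_eq (h.congr fun r => ?_)
  simp [circleMap]

theorem isRadialLimit_radialLimit {c : ℕ → ℂ} {g : ℝ → ℂ}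
    (h : ∀ᵐ θ, Tendsto (fun r : ℝ => powerSum c (circleMap 0 r θ)) (𝓝[<] 1) (𝓝 (g θ))) :
    IsRadialLimit c (radialLimit c) ∧ (fun θ => radialLimit c (circleMap 0 1 θ)) =ᵐ[volume] g := by
  constructor
  · filter_upwards [h] with θ hθ
    rwa [radialLimit_circleMap_eq hθ]
  · filter_upwards [h] with θ hθ
    exact radialLimit_circleMap_eq hθ

theorem integral_sq_norm_sub_average_le_of_bmoSeminorm_le {g : ℝ → ℍ[ℝ]} {B : ℝ} (hB : 0 ≤ B)
    (hg : bmoSeminorm g ≤ ENNReal.ofReal B) {a b : ℝ} (hab : a < b)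
    (hlen : b - a ≤ 2 * Real.pi) :
    ∫ θ in a..b, ‖g θ - (b - a)⁻¹ • ∫ t in a..b, g t‖ ^ 2 ≤ (b - a) * B ^ 2 := by
  have h1 : ENNReal.ofReal (((b - a)⁻¹ * ∫ θ in a..b,
      ‖g θ - (b - a)⁻¹ • ∫ t in a..b, g t‖ ^ 2) ^ (1 / 2 : ℝ)) ≤ ENNReal.ofReal B :=
    le_trans (le_iSup₂_of_le a b (by rw [iSup_pos hab, iSup_pos hlen])) hg
  rw [ENNReal.ofReal_le_ofReal_iff hB, ← Real.sqrt_eq_rpow, Real.sqrt_le_left hB,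
    inv_mul_le_iff₀ (sub_pos.mpr hab)] at h1
  exact h1

theorem hasOscillationBound_component {g : ℝ → ℍ[ℝ]} {u : ℝ → ℂ} {L : ℍ[ℝ] →L[ℝ] ℂ} {B : ℝ}
    (hL : ∀ q, ‖L q‖ ≤ ‖q‖) (hB : 0 ≤ B) (hg : bmoSeminorm g ≤ ENNReal.ofReal B)
    (hint : ∀ a b, IntervalIntegrable g volume a b)
    (hint2 : ∀ m a b, IntervalIntegrable (fun θ => ‖g θ - m‖ ^ 2) volume a b)
    (hu : u =ᵐ[volume] fun θ => L (g θ))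
    (hu2 : ∀ m a b, IntervalIntegrable (fun θ => ‖u θ - m‖ ^ 2) volume a b) :
    HasOscillationBound u B := by
  intro a b hab hlen
  refine le_trans ?_ (integral_sq_norm_sub_average_le_of_bmoSeminorm_le hB hg hab hlen)
  have h1 : ∫ t in a..b, u t = L (∫ t in a..b, g t) := by
    rw [← L.intervalIntegral_comp_comm (hint a b)]
    exact intervalIntegral.integral_congr_ae (hu.mono fun θ hθ _ => hθ)
  refine intervalIntegral.integral_mono_ae hab.le (hu2 _ _ _) (hint2 _ _ _) ?_
  filter_upwards [hu] with θ hθ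
  rw [hθ, h1, ← map_smul, ← map_sub]
  exact pow_le_pow_left₀ (norm_nonneg _) (hL _) 2

theorem circleAverage_norm_component_le {f : ℕ → ℍ[ℝ]} {L : ℍ[ℝ] →L[ℝ] ℂ} {F s : ℝ}
    (hL : ∀ q, ‖L q‖ ≤ ‖q‖)
    (hLmul : ∀ (w : ℂ) (q : ℍ[ℝ]), L (Quaternion.ofComplex w * q) = w * L q)
    (hf : ∀ r : ℝ, 0 ≤ r → r < 1 → Summable fun n => r ^ n * ‖f n‖) (hs : 0 < s) (hs1 : s < 1)
    (hF : (1 / (2 * Real.pi)) * ∫ θ in (-Real.pi)..Real.pi,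
      ‖∑' n : ℕ, (s • expQ (Quaternion.ofComplex Complex.I) θ) ^ n * f n‖ ≤ F) :
    Real.circleAverage (fun z => ‖powerSum (fun n => L (f n)) z‖) 0 s ≤ F := by
  refine le_trans ?_ hF
  have hcont : ∀ {L : ℍ[ℝ] →L[ℝ] ℂ}, (∀ q, ‖L q‖ ≤ ‖q‖) →
      Continuous fun θ => powerSum (fun n => L (f n)) (circleMap 0 s θ) := fun hL =>
    continuous_powerSum_circleMap (summable_pow_mul_norm_component hL hf) hs.le hs1
  have hper : Function.Periodic
      (fun θ => ‖powerSum (fun n => L (f n)) (circleMap 0 s θ)‖) (2 * Real.pi) := fun θ => by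
    simp only [periodic_circleMap 0 s θ]
  have hshift := hper.intervalIntegral_add_eq 0 (-Real.pi)
  rw [zero_add, show -Real.pi + 2 * Real.pi = Real.pi by ring] at hshift
  rw [Real.circleAverage_def, hshift, smul_eq_mul, one_div]
  gcongr
  have hq : Continuous fun θ =>
      ‖∑' n : ℕ, (s • expQ (Quaternion.ofComplex Complex.I) θ) ^ n * f n‖ := by
    simp only [tsum_expQ_pow_mul hs.le (hf s hs.le hs1)]
    exact (quaternionMk.continuous.comp
      ((hcont norm_complexFst_le).prodMk (hcont norm_complexSnd_le))).norm
  refine intervalIntegral.integral_mono_on (by linarith [Real.pi_pos])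
    ((hcont hL).norm.intervalIntegrable _ _) (hq.intervalIntegrable _ _) fun θ _ => ?_
  rw [← map_tsum_expQ_pow_mul hLmul hs.le (hf s hs.le hs1)]
  exact hL _

theorem isRadialLimit_component {b : ℕ → ℍ[ℝ]} {g : ℝ → ℍ[ℝ]} {L : ℍ[ℝ] →L[ℝ] ℂ}
    (hLmul : ∀ (w : ℂ) (q : ℍ[ℝ]), L (Quaternion.ofComplex w * q) = w * L q)
    (hb : Summable fun n => ‖b n‖ ^ 2)
    (hg : ∀ᵐ θ ∂(volume : Measure ℝ), Tendsto
      (fun r : ℝ => ∑' n : ℕ, (r • expQ (Quaternion.ofComplex Complex.I) θ) ^ n * b n)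
      (𝓝[<] (1 : ℝ)) (𝓝 (g θ))) :
    IsRadialLimit (fun n => L (b n)) (radialLimit fun n => L (b n)) ∧
      (fun θ => radialLimit (fun n => L (b n)) (circleMap 0 1 θ)) =ᵐ[volume]
        fun θ => L (g θ) := by
  refine isRadialLimit_radialLimit ?_
  filter_upwards [hg] with θ hθ
  refine ((L.continuous.tendsto _).comp hθ).congr' ?_
  filter_upwards [Ioo_mem_nhdsLT zero_lt_one] with r hr
  exact map_tsum_expQ_pow_mul hLmul hr.1.le
    (summable_pow_mul_norm_of_sq_quaternion hb r hr.1.le hr.2) θ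

section Pairing

variable {b f : ℕ → ℍ[ℝ]} {g : ℝ → ℍ[ℝ]} {B F r : ℝ}

theorem norm_tsum_conj_component_mul_component_le {L L' : ℍ[ℝ] →L[ℝ] ℂ}
    (hL : ∀ q, ‖L q‖ ≤ ‖q‖)
    (hLmul : ∀ (w : ℂ) (q : ℍ[ℝ]), L (Quaternion.ofComplex w * q) = w * L q)
    (hL' : ∀ q, ‖L' q‖ ≤ ‖q‖)
    (hLmul' : ∀ (w : ℂ) (q : ℍ[ℝ]), L' (Quaternion.ofComplex w * q) = w * L' q)
    (hb : Summable fun n => ‖b n‖ ^ 2)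
    (hg : ∀ᵐ θ ∂(volume : Measure ℝ), Tendsto
      (fun r : ℝ => ∑' n : ℕ, (r • expQ (Quaternion.ofComplex Complex.I) θ) ^ n * b n)
      (𝓝[<] (1 : ℝ)) (𝓝 (g θ)))
    (hB : 0 ≤ B) (hbmo : bmoSeminorm g ≤ ENNReal.ofReal B)
    (hf : ∀ r : ℝ, 0 ≤ r → r < 1 → Summable fun n => r ^ n * ‖f n‖)
    (hF : ∀ r : ℝ, 0 < r → r < 1 → (1 / (2 * Real.pi)) * ∫ θ in (-Real.pi)..Real.pi,
      ‖∑' n : ℕ, (r • expQ (Quaternion.ofComplex Complex.I) θ) ^ n * f n‖ ≤ F)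
    (hr : 0 < r) (hr1 : r < 1) :
    ‖∑' n, (r : ℂ) ^ n * (starRingEnd ℂ (L (b n)) * L' (f n))‖ ≤ 84 * (B + ‖b 0‖) * F := by
  obtain ⟨h1, e1⟩ := isRadialLimit_component complexFst_ofComplex_mul hb hg
  obtain ⟨h2, e2⟩ := isRadialLimit_component complexSnd_ofComplex_mul hb hg
  obtain ⟨h, e⟩ := isRadialLimit_component hLmul hb hg
  have s1 := summable_sq_norm_component norm_complexFst_le hb
  have s2 := summable_sq_norm_component norm_complexSnd_le hb
  have s := summable_sq_norm_component hL hb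
  have hF0 : 0 ≤ F := by
    refine le_trans ?_ (hF (1 / 2) (by norm_num) (by norm_num))
    exact mul_nonneg (by positivity) (intervalIntegral.integral_nonneg
      (by linarith [Real.pi_pos]) fun _ _ => norm_nonneg _)
  have hint : ∀ a b, IntervalIntegrable g volume a b := fun a b => by
    have i1 := h1.intervalIntegrable s1 a b
    have i2 := h2.intervalIntegrable s2 a b
    rw [intervalIntegrable_iff] at i1 i2 ⊢
    refine (quaternionMk.integrable_comp (i1.prodMk i2)).congr ?_
    filter_upwards [ae_restrict_of_ae e1, ae_restrict_of_ae e2] with θ h1 h2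
    rw [h1, h2, quaternionMk_components]
  have hint2 : ∀ m a b, IntervalIntegrable (fun θ => ‖g θ - m‖ ^ 2) volume a b := fun m a b => by
    refine ((intervalIntegrable_sq_norm_sub (h1.intervalIntegrable s1)
      (h1.intervalIntegrable_sq s1) (complexFst m) a b).add
      (intervalIntegrable_sq_norm_sub (h2.intervalIntegrable s2)
      (h2.intervalIntegrable_sq s2) (complexSnd m) a b)).congr_ae ?_
    filter_upwards [ae_restrict_of_ae e1, ae_restrict_of_ae e2] with θ h1 h2
    rw [sq_norm_eq_components (g θ - m), map_sub, map_sub, ← h1, ← h2]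
  have hosc := hasOscillationBound_component hL hB hbmo hint hint2 e
    (intervalIntegrable_sq_norm_sub (h.intervalIntegrable s) (h.intervalIntegrable_sq s))
  refine (norm_tsum_conj_mul_le s h hB hosc (summable_pow_mul_norm_component hL' hf)
    (fun t ht ht1 => circleAverage_norm_component_le hL' hLmul' hf ht ht1 (hF t ht ht1))
    hr hr1).trans ?_
  gcongr
  exact hL _

theorem summable_pow_mul_conj_component_mul_component {L L' : ℍ[ℝ] →L[ℝ] ℂ}
    (hL : ∀ q, ‖L q‖ ≤ ‖q‖) (hL' : ∀ q, ‖L' q‖ ≤ ‖q‖)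
    (h : Summable fun n => r ^ n * (‖b n‖ * ‖f n‖)) (hr : 0 ≤ r) :
    Summable fun n => (r : ℂ) ^ n * (starRingEnd ℂ (L (b n)) * L' (f n)) := by
  refine Summable.of_norm_bounded h fun n => ?_
  rw [norm_mul, norm_pow, norm_mul, RCLike.norm_conj, Complex.norm_real, Real.norm_of_nonneg hr]
  gcongr
  exacts [hL _, hL' _]

end Pairing

end Quaternion

/-- **Quaternionic Fefferman inequality: `BMOA(𝔹) ⊆ (H¹(𝔹))*`.**
There is a universal constant `C > 0` such that for every `b ∈ H²(𝔹)` with coefficients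
`b̌`, radial boundary functions `bstar I` on each slice and `B = ‖b‖_{BMOA(𝔹)}`, every
`f ∈ H¹(𝔹)` with coefficients `f̌` and `H¹`-norm (bounded by) `F`, and every `r ∈ (0,1)`,
`|∑ₙ rⁿ·conj(b̌(n))·f̌(n)| ≤ C·(B + |b̌(0)|)·F`. -/
theorem fefferman_inequality :
    ∃ C : ℝ, 0 < C ∧
      ∀ b : ℕ → ℍ[ℝ], Summable (fun n => ‖b n‖ ^ 2) →
      ∀ bstar : ℍ[ℝ] → ℝ → ℍ[ℝ],
        (∀ I : ℍ[ℝ], I.re = 0 → ‖I‖ = 1 → ∀ᵐ θ ∂(volume : Measure ℝ),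
          Tendsto (fun r : ℝ => ∑' n : ℕ, (r • expQ I θ) ^ n * b n) (𝓝[<] (1 : ℝ))
            (𝓝 (bstar I θ))) →
      ∀ B : ℝ, 0 ≤ B →
        (⨆ (I : ℍ[ℝ]) (_ : I.re = 0 ∧ ‖I‖ = 1), bmoSeminorm (bstar I))
          ≤ ENNReal.ofReal B →
      ∀ f : ℕ → ℍ[ℝ], (∀ r : ℝ, 0 ≤ r → r < 1 → Summable fun n => r ^ n * ‖f n‖) →
      ∀ F : ℝ,
        (∀ I : ℍ[ℝ], I.re = 0 → ‖I‖ = 1 → ∀ r : ℝ, 0 < r → r < 1 →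
          (1 / (2 * Real.pi)) *
              ∫ θ in (-Real.pi)..Real.pi, ‖∑' n : ℕ, (r • expQ I θ) ^ n * f n‖ ≤ F) →
      ∀ r : ℝ, 0 < r → r < 1 →
        ‖∑' n : ℕ, (r ^ n : ℝ) • (star (b n) * f n)‖ ≤ C * (B + ‖b 0‖) * F := by
  refine ⟨336, by norm_num, fun b hb bstar hbstar B hB hbmo f hf F hF r hr hr1 => ?_⟩
  have hI : (Quaternion.ofComplex Complex.I).re = 0 := by simp
  have hI1 : ‖Quaternion.ofComplex Complex.I‖ = 1 := by
    rw [norm_quaternion_ofComplex, Complex.norm_I]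
  have hg := hbstar _ hI hI1
  have hbmo' := (le_iSup₂_of_le (f := fun (I : ℍ[ℝ]) (_ : I.re = 0 ∧ ‖I‖ = 1) =>
    bmoSeminorm (bstar I)) _ ⟨hI, hI1⟩ le_rfl).trans hbmo
  have hF' := hF _ hI hI1
  obtain ⟨K, hK⟩ : ∃ K, ∀ n, ‖b n‖ ≤ K := by
    obtain ⟨K, hK⟩ := hb.tendsto_atTop_zero.bddAbove_range
    exact ⟨√K, fun n => Real.le_sqrt_of_sq_le (hK ⟨n, rfl⟩)⟩
  have hsum : Summable fun n => r ^ n * (‖b n‖ * ‖f n‖) := by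
    refine Summable.of_nonneg_of_le (fun n => by positivity) (fun n => ?_)
      ((hf r hr.le hr1).mul_left K)
    rw [mul_left_comm]
    exact mul_le_mul_of_nonneg_right (hK n) (by positivity)
  have hsumQ : Summable fun n => (r ^ n : ℝ) • (star (b n) * f n) := by
    refine Summable.of_norm_bounded hsum fun n => ?_
    rw [norm_smul, norm_mul, norm_star, Real.norm_of_nonneg (by positivity)]
  have bound : ∀ {L L' : ℍ[ℝ] →L[ℝ] ℂ}, (∀ q, ‖L q‖ ≤ ‖q‖) →
      (∀ (w : ℂ) (q : ℍ[ℝ]), L (Quaternion.ofComplex w * q) = w * L q) →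
      (∀ q, ‖L' q‖ ≤ ‖q‖) →
      (∀ (w : ℂ) (q : ℍ[ℝ]), L' (Quaternion.ofComplex w * q) = w * L' q) →
      ‖∑' n, (r : ℂ) ^ n * (starRingEnd ℂ (L (b n)) * L' (f n))‖ ≤ 84 * (B + ‖b 0‖) * F :=
    fun hL hLmul hL' hLmul' => norm_tsum_conj_component_mul_component_le hL hLmul hL' hLmul'
      hb hg hB hbmo' hf hF' hr hr1
  have summ : ∀ {L L' : ℍ[ℝ] →L[ℝ] ℂ}, (∀ q, ‖L q‖ ≤ ‖q‖) → (∀ q, ‖L' q‖ ≤ ‖q‖) →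
      Summable fun n => (r : ℂ) ^ n * (starRingEnd ℂ (L (b n)) * L' (f n)) :=
    fun hL hL' => summable_pow_mul_conj_component_mul_component hL hL' hsum hr.le
  have e1 : complexFst (∑' n, (r ^ n : ℝ) • (star (b n) * f n)) =
      ∑' n, (r : ℂ) ^ n * (starRingEnd ℂ (complexFst (b n)) * complexFst (f n)) +
      starRingEnd ℂ (∑' n, (r : ℂ) ^ n *
        (starRingEnd ℂ (complexSnd (b n)) * complexSnd (f n))) := by
    rw [complexFst.map_tsum hsumQ, Complex.conj_tsum,
      ← (summ norm_complexFst_le norm_complexFst_le).tsum_add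
        (Complex.summable_conj.mpr (summ norm_complexSnd_le norm_complexSnd_le))]
    refine tsum_congr fun n => ?_
    rw [map_smul, complexFst_star_mul, Complex.real_smul]
    simp [mul_add]
  have e2 : complexSnd (∑' n, (r ^ n : ℝ) • (star (b n) * f n)) =
      ∑' n, (r : ℂ) ^ n * (starRingEnd ℂ (complexFst (b n)) * complexSnd (f n)) -
      starRingEnd ℂ (∑' n, (r : ℂ) ^ n *
        (starRingEnd ℂ (complexSnd (b n)) * complexFst (f n))) := by
    rw [complexSnd.map_tsum hsumQ, Complex.conj_tsum,
      ← (summ norm_complexFst_le norm_complexSnd_le).tsum_sub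
        (Complex.summable_conj.mpr (summ norm_complexSnd_le norm_complexFst_le))]
    refine tsum_congr fun n => ?_
    rw [map_smul, complexSnd_star_mul, Complex.real_smul]
    simp [mul_sub]
  have h1 := norm_add_le
    (∑' n, (r : ℂ) ^ n * (starRingEnd ℂ (complexFst (b n)) * complexFst (f n)))
    (starRingEnd ℂ (∑' n, (r : ℂ) ^ n *
      (starRingEnd ℂ (complexSnd (b n)) * complexSnd (f n))))
  have h2 := norm_sub_le
    (∑' n, (r : ℂ) ^ n * (starRingEnd ℂ (complexFst (b n)) * complexSnd (f n)))
    (starRingEnd ℂ (∑' n, (r : ℂ) ^ n *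
      (starRingEnd ℂ (complexSnd (b n)) * complexFst (f n))))
  rw [← e1, RCLike.norm_conj] at h1
  rw [← e2, RCLike.norm_conj] at h2
  have b1 := bound norm_complexFst_le complexFst_ofComplex_mul
    norm_complexFst_le complexFst_ofComplex_mul
  have b2 := bound norm_complexSnd_le complexSnd_ofComplex_mul
    norm_complexSnd_le complexSnd_ofComplex_mul
  have b3 := bound norm_complexFst_le complexFst_ofComplex_mul
    norm_complexSnd_le complexSnd_ofComplex_mul
  have b4 := bound norm_complexSnd_le complexSnd_ofComplex_mul
    norm_complexFst_le complexFst_ofComplex_mul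
  linarith [norm_le_norm_components (∑' n, (r ^ n : ℝ) • (star (b n) * f n))]
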